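/- arXiv:1503.02245 — 7 statements merged into one kernel-verified Lean document; each statement's English description precedes it below -/
import Mathlib

section
/- A commutative ring R is an a-ring (i.e., every ideal of R is automorphism-invariant as an R-module) if and only if R is automorphism-invariant as a module over itself. -/
/-- A module `M` over a ring `A` is *automorphism-invariant* if every injective
`A`-linear map from a submodule of `M` into `M` extends to an endomorphism of `M`. -/
def IsAutomorphismInvariant (A : Type*) [Ring A] (M : Type*) [AddCommGroup M]
    [Module A M] : Prop :=
  ∀ (N : Submodule A M) (f : N →ₗ[A] M), Function.Injective f →
    ∃ g : M →ₗ[A] M, ∀ n : N, g n = f n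

/-- A module `M` over a ring `A` is *quasi-injective* if every `A`-linear map
from a submodule of `M` into `M` extends to an endomorphism of `M`. -/
def IsQuasiInjective (A : Type*) [Ring A] (M : Type*) [AddCommGroup M]
    [Module A M] : Prop :=
  ∀ (N : Submodule A M) (f : N →ₗ[A] M), ∃ g : M →ₗ[A] M, ∀ n : N, g n = f n

/-- Right ideals of `R` are the `Rᵐᵒᵖ`-submodules of `R`.  A ring `R` is a *right
`a`-ring* if every right ideal of `R` is automorphism-invariant as a right `R`-module
(i.e. as an `Rᵐᵒᵖ`-module). -/
def IsRightARing (R : Type*) [Ring R] : Prop :=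
  ∀ I : Submodule Rᵐᵒᵖ R, IsAutomorphismInvariant Rᵐᵒᵖ I

/-- A ring `R` is a *right `q`-ring* if every right ideal of `R` is quasi-injective
as a right `R`-module. -/
def IsRightQRing (R : Type*) [Ring R] : Prop :=
  ∀ I : Submodule Rᵐᵒᵖ R, IsQuasiInjective Rᵐᵒᵖ I

/-- A right ideal is *essential* if it intersects every nonzero right ideal
nontrivially. -/
def IsEssentialRightIdeal (R : Type*) [Ring R] (I : Submodule Rᵐᵒᵖ R) : Prop :=
  ∀ J : Submodule Rᵐᵒᵖ R, I ⊓ J = ⊥ → J = ⊥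

/-- The right ideal `eR` generated by an element `e`. -/
def rightIdealOf (R : Type*) [Ring R] (e : R) : Submodule Rᵐᵒᵖ R where
  carrier := {x : R | ∃ r : R, x = e * r}
  zero_mem' := ⟨0, by simp⟩
  add_mem' := by rintro x y ⟨r, rfl⟩ ⟨s, rfl⟩; exact ⟨r + s, by rw [mul_add]⟩
  smul_mem' := by
    rintro c x ⟨r, rfl⟩
    exact ⟨r * c.unop, by rw [MulOpposite.smul_eq_mul_unop, mul_assoc]⟩

/-- The right annihilator of an element `a` of `R`, as a right ideal. -/
def rightAnnihilator (R : Type*) [Ring R] (a : R) : Submodule Rᵐᵒᵖ R where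
  carrier := {r : R | a * r = 0}
  zero_mem' := by simp
  add_mem' := by
    intro x y hx hy
    simp only [Set.mem_setOf_eq] at *
    rw [mul_add, hx, hy, add_zero]
  smul_mem' := by
    intro c x hx
    simp only [Set.mem_setOf_eq] at *
    rw [MulOpposite.smul_eq_mul_unop, ← mul_assoc, hx, zero_mul]

/-- The socle of a module: the sum of all its simple submodules. -/
def moduleSocle (A : Type*) [Ring A] (M : Type*) [AddCommGroup M] [Module A M] :
    Submodule A M :=
  sSup {N : Submodule A M | IsSimpleModule A N}

/-- A module is *square-free* if it contains no pair of nonzero independent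
isomorphic submodules (equivalently, no nonzero submodule isomorphic to `X ⊕ X`). -/
def IsSquareFreeModule (A : Type*) [Ring A] (M : Type*) [AddCommGroup M]
    [Module A M] : Prop :=
  ∀ N₁ N₂ : Submodule A M, N₁ ⊓ N₂ = ⊥ → Nonempty ((N₁ : Type _) ≃ₗ[A] N₂) → N₁ = ⊥

/-- A module `M` is *square-full* if every nonzero submodule of `M` contains a
nonzero submodule `N` such that `N ⊕ N` embeds in `M`. -/
def IsSquareFullModule (A : Type*) [Ring A] (M : Type*) [AddCommGroup M]
    [Module A M] : Prop :=
  ∀ U : Submodule A M, U ≠ ⊥ → ∃ N N₁ N₂ : Submodule A M, N ≠ ⊥ ∧ N ≤ U ∧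
    N₁ ⊓ N₂ = ⊥ ∧ Nonempty ((N : Type _) ≃ₗ[A] N₁) ∧ Nonempty ((N : Type _) ≃ₗ[A] N₂)

/-- A *CS module*: every submodule is essential in a direct summand. -/
def IsCSModule (A : Type*) [Ring A] (M : Type*) [AddCommGroup M] [Module A M] : Prop :=
  ∀ N : Submodule A M, ∃ D : Submodule A M, (∃ D' : Submodule A M, IsCompl D D') ∧
    N ≤ D ∧ ∀ K : Submodule A M, K ≤ D → K ⊓ N = ⊥ → K = ⊥

/-- A *weak CS module*: every semisimple submodule is essential in a direct summand. -/
def IsWeakCSModule (A : Type*) [Ring A] (M : Type*) [AddCommGroup M] [Module A M] : Prop :=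
  ∀ N : Submodule A M, IsSemisimpleModule A N → ∃ D : Submodule A M,
    (∃ D' : Submodule A M, IsCompl D D') ∧ N ≤ D ∧
      ∀ K : Submodule A M, K ≤ D → K ⊓ N = ⊥ → K = ⊥

/-- A *uniform module*: nonzero, and any two nonzero submodules intersect
nontrivially. -/
def IsUniformModule (A : Type*) [Ring A] (M : Type*) [AddCommGroup M] [Module A M] : Prop :=
  (⊤ : Submodule A M) ≠ ⊥ ∧ ∀ N₁ N₂ : Submodule A M, N₁ ≠ ⊥ → N₂ ≠ ⊥ → N₁ ⊓ N₂ ≠ ⊥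

/-- A ring is *semiprime* if it has no nonzero nilpotent two-sided ideal. -/
def IsSemiprimeRing (R : Type*) [Ring R] : Prop :=
  ∀ I : TwoSidedIdeal R, (∃ n : ℕ, n ≠ 0 ∧
    ∀ l : List R, l.length = n → (∀ x ∈ l, x ∈ I) → l.prod = 0) → I = ⊥

/-- A ring is *prime* if the product of any two nonzero two-sided ideals is nonzero. -/
def IsPrimeRing (R : Type*) [Ring R] : Prop :=
  ∀ I J : TwoSidedIdeal R, I ≠ ⊥ → J ≠ ⊥ → ∃ x ∈ I, ∃ y ∈ J, x * y ≠ 0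

/-- A ring is *von Neumann regular* if every element `a` satisfies `a = a * b * a`
for some `b`. -/
def IsVonNeumannRegularRing (R : Type*) [Ring R] : Prop :=
  ∀ a : R, ∃ b : R, a = a * b * a

/-- Automorphism-invariance is transported along linear equivalences. -/
theorem IsAutomorphismInvariant.of_linearEquiv {A M M' : Type*} [Ring A] [AddCommGroup M]
    [Module A M] [AddCommGroup M'] [Module A M'] (e : M ≃ₗ[A] M')
    (h : IsAutomorphismInvariant A M) : IsAutomorphismInvariant A M' := by
  intro N f hf
  let k := (e.submoduleMap (N.map (e.symm : M' →ₗ[A] M))).trans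
    (LinearEquiv.ofEq _ N (by ext x; simp))
  obtain ⟨g, hg⟩ := h _ ((e.symm : M' →ₗ[A] M) ∘ₗ f ∘ₗ k.toLinearMap)
    (e.symm.injective.comp (hf.comp k.injective))
  refine ⟨(e : M →ₗ[A] M') ∘ₗ g ∘ₗ (e.symm : M' →ₗ[A] M), fun n => ?_⟩
  have hn := hg ⟨e.symm n, Submodule.mem_map_of_mem n.2⟩
  have hk : k ⟨e.symm n, Submodule.mem_map_of_mem n.2⟩ = n :=
    Subtype.ext (e.apply_symm_apply (n : M'))
  simp only [LinearMap.comp_apply, LinearEquiv.coe_coe, hk] at hn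
  simp [hn]

/-- An ideal of a commutative automorphism-invariant ring is automorphism-invariant: the
extensions are multiplications by ring elements, which preserve every ideal. -/
theorem IsAutomorphismInvariant.ideal {R : Type*} [CommRing R]
    (h : IsAutomorphismInvariant R R) (I : Ideal R) : IsAutomorphismInvariant R I := by
  intro N f hf
  let k := Submodule.equivSubtypeMap I N
  obtain ⟨g, hg⟩ := h (N.map I.subtype) (I.subtype ∘ₗ f ∘ₗ k.symm.toLinearMap)
    (I.injective_subtype.comp (hf.comp k.symm.injective))
  refine ⟨LinearMap.lsmul R I (g 1), fun n => Subtype.ext ?_⟩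
  have hn : g ((n : I) : R) = f n := by
    simpa [k] using hg (k n)
  have hmul : g ((n : I) : R) = ((n : I) : R) * g 1 := by
    rw [← smul_eq_mul, ← map_smul, smul_eq_mul, mul_one]
  simp [← hn, hmul, mul_comm]

/-- A commutative ring `R` is an `a`-ring (every ideal of `R` is
automorphism-invariant as an `R`-module) iff `R` is automorphism-invariant as a
module over itself. -/
theorem commRing_aRing_iff_automorphismInvariant (R : Type*) [CommRing R] :
    (∀ I : Ideal R, IsAutomorphismInvariant R I) ↔ IsAutomorphismInvariant R R := by
  exact ⟨fun h => (h ⊤).of_linearEquiv Submodule.topEquiv, fun h I => h.ideal I⟩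
end

section
/- For a ring R the following conditions are equivalent: (1) R is a right a-ring; (2) every essential right ideal of R is automorphism-invariant; (3) R is right automorphism-invariant (R is automorphism-invariant as a right module over itself) and uI ⊆ I for every essential right ideal I of R and every unit u of R. -/
namespace AutomorphismInvariant

variable {A M : Type*} [Ring A] [AddCommGroup M] [Module A M]

/-- `N` meets every nonzero submodule of `Q`. -/
def IsEssentialIn (N Q : Submodule A M) : Prop :=
  ∀ J ≤ Q, Disjoint N J → J = ⊥

theorem IsEssentialIn.mono {N N' Q : Submodule A M} (h : IsEssentialIn N Q) (hN : N ≤ N') :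
    IsEssentialIn N' Q :=
  fun J hJ hd => h J hJ (hd.mono_left hN)

theorem IsEssentialIn.inf {N N' : Submodule A M} (h : IsEssentialIn N ⊤)
    (h' : IsEssentialIn N' ⊤) : IsEssentialIn (N ⊓ N') ⊤ := by
  intro J _ hd
  refine h J le_top ?_
  rw [disjoint_iff]
  refine h' _ le_top ?_
  rw [disjoint_iff, ← inf_assoc, inf_comm N' N]
  exact hd.eq_bot

theorem IsEssentialIn.comap {N : Submodule A M} (h : IsEssentialIn N ⊤) (g : Module.End A M) :
    IsEssentialIn (N.comap g) ⊤ := by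
  intro J _ hd
  rw [Submodule.disjoint_def] at hd
  have hJ : J.map g = ⊥ := by
    refine h _ le_top ?_
    rw [Submodule.disjoint_def]
    rintro _ hx ⟨y, hy, rfl⟩
    rw [hd y hx hy, map_zero]
  rw [Submodule.eq_bot_iff] at hJ ⊢
  intro x hx
  refine hd x ?_ hx
  rw [Submodule.mem_comap, hJ _ ⟨x, hx, rfl⟩]
  exact N.zero_mem

theorem IsEssentialIn.sup {Y K P Q : Submodule A M} (h : IsEssentialIn Y K) (hY : Y ≤ K)
    (hd : Disjoint K P) (hQ : IsEssentialIn (K ⊔ P) Q) : IsEssentialIn (Y ⊔ P) Q := by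
  intro J hJ hJd
  rw [Submodule.disjoint_def] at hJd hd
  have h1 : K ⊓ (J ⊔ P) = ⊥ := by
    refine h _ inf_le_left ?_
    rw [Submodule.disjoint_def]
    rintro y hy ⟨-, hy'⟩
    obtain ⟨j, hj, p, hp, rfl⟩ := Submodule.mem_sup.1 hy'
    have hj0 : j = 0 := by
      refine hJd j ?_ hj
      have := Submodule.sub_mem _ (Submodule.mem_sup_left hy) (Submodule.mem_sup_right (S := Y) hp)
      simpa using this
    subst hj0
    exact hd _ (hY hy) (by simpa using hp)
  refine hQ J hJ ?_
  rw [Submodule.disjoint_def]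
  intro j hj hjJ
  obtain ⟨k, hk, p, hp, rfl⟩ := Submodule.mem_sup.1 hj
  have hk0 : k = 0 := by
    refine (Submodule.eq_bot_iff _).1 h1 k ⟨hk, ?_⟩
    have := Submodule.sub_mem _ (Submodule.mem_sup_left hjJ) (Submodule.mem_sup_right (S := J) hp)
    simpa using this
  subst hk0
  exact hJd _ (Submodule.mem_sup_right (by simpa using hp)) hjJ

theorem exists_maximal_pairwise {V : Type*} [AddCommGroup V] [Module A V] (r : V → V → Prop)
    (h0 : r 0 0) : ∃ G : Submodule A V, Maximal (fun G => ∀ p ∈ G, ∀ q ∈ G, r p q) G := by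
  suffices h : ∃ m, ⊥ ≤ m ∧
      Maximal (· ∈ {G : Submodule A V | ∀ p ∈ G, ∀ q ∈ G, r p q}) m by
    obtain ⟨m, -, hm⟩ := h
    exact ⟨m, hm⟩
  refine zorn_le_nonempty₀ _ ?_ ⊥ ?_
  · intro c hc hch y hy
    refine ⟨sSup c, ?_, fun z hz => le_sSup hz⟩
    intro p hp q hq
    obtain ⟨G, hG, hpG⟩ := (Submodule.mem_sSup_of_directed ⟨y, hy⟩ hch.directedOn).1 hp
    obtain ⟨H, hH, hqH⟩ := (Submodule.mem_sSup_of_directed ⟨y, hy⟩ hch.directedOn).1 hq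
    rcases hch.total hG hH with h | h
    · exact hc hH p (h hpG) q hqH
    · exact hc hG p hpG q (h hqH)
  · intro p hp q hq
    rw [Submodule.mem_bot] at hp hq
    rwa [hp, hq]

theorem exists_complement (N Q : Submodule A M) :
    ∃ C ≤ Q, Disjoint N C ∧ IsEssentialIn (N ⊔ C) Q := by
  obtain ⟨C, hC, hmax⟩ := exists_maximal_pairwise (A := A)
    (fun x _ : M => x ∈ Q ∧ (x ∈ N → x = 0)) ⟨Q.zero_mem, fun _ => rfl⟩
  refine ⟨C, fun x hx => (hC x hx x hx).1, ?_, ?_⟩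
  · rw [Submodule.disjoint_def]
    exact fun x hx hxC => (hC x hxC x hxC).2 hx
  · intro J hJ hd
    have hle : C ⊔ J ≤ C := by
      refine hmax ?_ le_sup_left
      intro x hx _ _
      obtain ⟨c, hc, j, hj, rfl⟩ := Submodule.mem_sup.1 hx
      refine ⟨Q.add_mem (hC c hc c hc).1 (hJ hj), fun hN => ?_⟩
      have hj0 : j = 0 := by
        refine Submodule.disjoint_def.1 hd j ?_ hj
        have := Submodule.sub_mem _ (Submodule.mem_sup_left hN)
          (Submodule.mem_sup_right (S := N) hc)
        simpa using this
      subst hj0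
      simpa using (hC c hc c hc).2 (by simpa using hN)
    have : J ≤ N ⊔ C := (le_sup_right.trans hle).trans le_sup_right
    exact (disjoint_self.1 (hd.mono_left this))

theorem exists_extension (hM : IsAutomorphismInvariant A M) {X : Type*} [AddCommGroup X]
    [Module A X] (i f : X →ₗ[A] M) (hi : Function.Injective i) (hf : Function.Injective f) :
    ∃ g : Module.End A M, ∀ x, g (i x) = f x := by
  let e := LinearEquiv.ofInjective i hi
  obtain ⟨g, hg⟩ := hM (LinearMap.range i) (f ∘ₗ e.symm.toLinearMap)
    (hf.comp e.symm.injective)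
  refine ⟨g, fun x => ?_⟩
  have := hg (e x)
  simpa [e] using this

theorem isUnit_of_essential (hM : IsAutomorphismInvariant A M) {N : Submodule A M}
    (hN : IsEssentialIn N ⊤) (g : Module.End A M) (hg : ∀ x ∈ N, g x = 0 → x = 0)
    (hgN : IsEssentialIn (N.map g) ⊤) : IsUnit g := by
  have hinj : Function.Injective g := by
    rw [← LinearMap.ker_eq_bot]
    refine hN _ le_top ?_
    rw [Submodule.disjoint_def]
    exact fun x hx hxk => hg x hx hxk
  obtain ⟨b, hb⟩ := exists_extension hM g LinearMap.id hinj Function.injective_id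
  have hbinj : Function.Injective b := by
    rw [← LinearMap.ker_eq_bot]
    refine hgN _ le_top ?_
    rw [Submodule.disjoint_def]
    rintro _ ⟨y, -, rfl⟩ hy
    have hy' : b (g y) = 0 := hy
    rw [hb] at hy'
    rw [show y = 0 from hy', map_zero]
  refine ⟨⟨g, b, ?_, ?_⟩, rfl⟩
  · ext x
    apply hbinj
    exact hb (b x)
  · ext x
    exact hb x

theorem exists_unit (hM : IsAutomorphismInvariant A M) {N D : Submodule A M}
    (hd : Disjoint N D) (hess : IsEssentialIn (N ⊔ D) ⊤) (f : Module.End A M)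
    (hf : ∀ x ∈ N, f x ∈ D → x = 0) (hfess : IsEssentialIn (N.map f ⊔ D) ⊤) :
    ∃ u : Module.End A M, IsUnit u ∧ (∀ x ∈ N, u x = f x) ∧ ∀ x ∈ D, u x = x := by
  have hi : Function.Injective (N.subtype.coprod D.subtype) := by
    rw [← LinearMap.ker_eq_bot, LinearMap.ker_eq_bot']
    rintro ⟨⟨n, hn⟩, ⟨d, hd'⟩⟩ h
    have h' : n + d = 0 := h
    have hn0 : n = 0 := Submodule.disjoint_def.1 hd n hn
      (by rw [eq_neg_of_add_eq_zero_left h']; exact D.neg_mem hd')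
    subst hn0
    have : d = 0 := by simpa using h'
    subst this
    rfl
  have hfi : Function.Injective ((f ∘ₗ N.subtype).coprod D.subtype) := by
    rw [← LinearMap.ker_eq_bot, LinearMap.ker_eq_bot']
    rintro ⟨⟨n, hn⟩, ⟨d, hd'⟩⟩ h
    have h' : f n + d = 0 := h
    have hn0 : n = 0 := hf n hn (by rw [eq_neg_of_add_eq_zero_left h']; exact D.neg_mem hd')
    subst hn0
    have : d = 0 := by simpa using h'
    subst this
    rfl
  obtain ⟨u, hu⟩ := exists_extension hM _ _ hi hfi
  have h1 : ∀ x ∈ N, u x = f x := fun x hx => by simpa using hu (⟨x, hx⟩, 0)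
  have h2 : ∀ x ∈ D, u x = x := fun x hx => by simpa using hu (0, ⟨x, hx⟩)
  refine ⟨u, isUnit_of_essential hM hess u ?_ ?_, h1, h2⟩
  · intro x hx hux
    obtain ⟨n, hn, d, hd', rfl⟩ := Submodule.mem_sup.1 hx
    rw [map_add, h1 n hn, h2 d hd'] at hux
    have hn0 := hf n hn (by rw [eq_neg_of_add_eq_zero_left hux]; exact D.neg_mem hd')
    subst hn0
    simpa using hux
  · refine hfess.mono (sup_le ?_ ?_)
    · rintro _ ⟨x, hx, rfl⟩
      exact ⟨x, Submodule.mem_sup_left hx, h1 x hx⟩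
    · intro x hx
      exact ⟨x, Submodule.mem_sup_right hx, h2 x hx⟩

/-- A partial map into `D`, given by its graph `G` and defined on a submodule independent
of `D`, extends to an endomorphism vanishing on `D`. -/
theorem exists_extension_zero (hM : IsAutomorphismInvariant A M) (G : Submodule A (M × M))
    (D : Submodule A M) (h1 : ∀ g ∈ G, g.1 ∈ D → g = 0) (h2 : ∀ g ∈ G, g.2 ∈ D) :
    ∃ s : Module.End A M, (∀ g ∈ G, s g.1 = g.2) ∧ ∀ d ∈ D, s d = 0 := by
  let i : (G × D) →ₗ[A] M := (LinearMap.fst A M M ∘ₗ G.subtype).coprod D.subtype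
  let f : (G × D) →ₗ[A] M :=
    ((LinearMap.fst A M M + LinearMap.snd A M M) ∘ₗ G.subtype).coprod D.subtype
  have key : ∀ (g : G) (d d' : D), g.1.1 + d'.1 = 0 → g = 0 ∧ d'.1 = 0 := by
    intro g d d' h
    have hg : g.1 = 0 := h1 g.1 g.2
      (by rw [eq_neg_of_add_eq_zero_left h]; exact D.neg_mem d'.2)
    refine ⟨Subtype.ext hg, ?_⟩
    rw [hg] at h
    simpa using h
  have hi : Function.Injective i := by
    rw [← LinearMap.ker_eq_bot, LinearMap.ker_eq_bot']
    rintro ⟨g, d⟩ h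
    obtain ⟨hg, hd⟩ := key g d d h
    exact Prod.ext hg (Subtype.ext hd)
  have hfi : Function.Injective f := by
    rw [← LinearMap.ker_eq_bot, LinearMap.ker_eq_bot']
    rintro ⟨g, d⟩ h
    have h' : g.1.1 + g.1.2 + d.1 = 0 := h
    rw [add_assoc] at h'
    obtain ⟨hg, hd⟩ := key g d ⟨g.1.2 + d.1, D.add_mem (h2 _ g.2) d.2⟩ h'
    subst hg
    exact Prod.ext rfl (Subtype.ext (by simpa using hd))
  obtain ⟨u, hu⟩ := exists_extension hM i f hi hfi
  refine ⟨u - 1, fun g hg => ?_, fun d hd => ?_⟩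
  · have := hu (⟨g, hg⟩, 0)
    simp only [i, f, LinearMap.coprod_apply, LinearMap.comp_apply, Submodule.subtype_apply,
      LinearMap.add_apply, LinearMap.fst_apply, LinearMap.snd_apply, ZeroMemClass.coe_zero,
      add_zero] at this
    simp [this]
  · have := hu (0, ⟨d, hd⟩)
    simp only [i, f, LinearMap.coprod_apply, map_zero, Submodule.subtype_apply,
      zero_add] at this
    simp [this]

/-- The endomorphisms with essential kernel. -/
def singularIdeal (A M : Type*) [Ring A] [AddCommGroup M] [Module A M] :
    Ideal (Module.End A M) where
  carrier := {z | IsEssentialIn (LinearMap.ker z) ⊤}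
  zero_mem' := by
    intro J _ hd
    simpa using hd
  add_mem' := by
    intro a b ha hb
    refine (ha.inf hb).mono ?_
    rintro x ⟨hx, hx'⟩
    rw [LinearMap.mem_ker, LinearMap.add_apply, LinearMap.mem_ker.1 hx, LinearMap.mem_ker.1 hx',
      add_zero]
  smul_mem' := by
    intro s z hz
    refine hz.mono fun x hx => ?_
    rw [LinearMap.mem_ker, smul_eq_mul, Module.End.mul_apply, LinearMap.mem_ker.1 hx, map_zero]

theorem mem_singularIdeal {z : Module.End A M} :
    z ∈ singularIdeal A M ↔ IsEssentialIn (LinearMap.ker z) ⊤ := Iff.rfl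

instance : (singularIdeal A M).IsTwoSided where
  mul_mem_of_left {z} s hz := by
    rw [mem_singularIdeal] at hz ⊢
    exact (hz.comap s).mono fun x hx => hx

theorem isUnit_one_add (hM : IsAutomorphismInvariant A M) {z : Module.End A M}
    (hz : z ∈ singularIdeal A M) : IsUnit (1 + z) := by
  have h : ∀ x ∈ LinearMap.ker z, (1 + z) x = x := fun x hx => by
    simp [LinearMap.mem_ker.1 hx]
  refine isUnit_of_essential hM hz _ (fun x hx h0 => by rwa [h x hx] at h0) ?_
  exact IsEssentialIn.mono hz fun x hx => ⟨x, hx, h x hx⟩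

theorem isUnit_of_isUnit_mk (hM : IsAutomorphismInvariant A M) {g : Module.End A M}
    (hg : IsUnit (Ideal.Quotient.mk (singularIdeal A M) g)) : IsUnit g := by
  obtain ⟨b, hb⟩ := Ideal.Quotient.mk_surjective (hg.unit⁻¹.1)
  have unit_of_mk_eq_one : ∀ c : Module.End A M,
      Ideal.Quotient.mk (singularIdeal A M) c = 1 → IsUnit c := by
    intro c hc
    rw [← map_one (Ideal.Quotient.mk _), Ideal.Quotient.mk_eq_mk_iff_sub_mem] at hc
    simpa using isUnit_one_add hM hc
  have h1 : IsUnit (g * b) := unit_of_mk_eq_one _ (by rw [map_mul, hb]; exact hg.mul_val_inv)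
  have h2 : IsUnit (b * g) := unit_of_mk_eq_one _ (by rw [map_mul, hb]; exact hg.val_inv_mul)
  obtain ⟨c, hc⟩ := h1.exists_right_inv
  obtain ⟨d, hd⟩ := h2.exists_left_inv
  have hgc : g * (b * c) = 1 := by rw [← mul_assoc, hc]
  have hdg : (d * b) * g = 1 := by rw [mul_assoc, hd]
  have heq : d * b = b * c := left_inv_eq_right_inv hdg hgc
  exact ⟨⟨g, b * c, hgc, by rw [← heq, hdg]⟩, rfl⟩

section Ring

variable {Q : Type*} [Ring Q] {T : Subring Q}

theorem mem_of_mul_self_eq_zero (hT : ∀ u : Q, IsUnit u → u ∈ T) {n : Q} (hn : n * n = 0) :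
    n ∈ T := by
  have h : IsUnit (1 + n) :=
    ⟨⟨1 + n, 1 - n, by noncomm_ring; simp [hn], by noncomm_ring; simp [hn]⟩, rfl⟩
  simpa using T.sub_mem (hT _ h) T.one_mem

theorem offDiagonal_mem (hT : ∀ u : Q, IsUnit u → u ∈ T) {e : Q} (he : e * e = e) (s : Q) :
    e * s * (1 - e) ∈ T ∧ (1 - e) * s * e ∈ T := by
  have h1 : (1 - e) * e = 0 := by rw [sub_mul, he, one_mul, sub_self]
  have h2 : e * (1 - e) = 0 := by rw [mul_sub, he, mul_one, sub_self]
  constructor <;> apply mem_of_mul_self_eq_zero hT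
  · rw [show e * s * (1 - e) * (e * s * (1 - e)) = e * s * ((1 - e) * e) * s * (1 - e) by
      simp only [mul_assoc], h1]
    simp
  · rw [show (1 - e) * s * e * ((1 - e) * s * e) = (1 - e) * s * (e * (1 - e)) * s * e by
      simp only [mul_assoc], h2]
    simp

/-- An idempotent `b * a` which factors through its complement generates one-sided ideals
contained in every subring containing all units. -/
theorem corner_mem (hT : ∀ u : Q, IsUnit u → u ∈ T) {a b : Q}
    (he : b * a * (b * a) = b * a) (ha : b * a * a = 0) (s : Q) :
    b * a * s ∈ T ∧ s * (b * a) ∈ T := by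
  obtain ⟨e, he'⟩ : ∃ e, e = b * a := ⟨_, rfl⟩
  rw [← he'] at he ha ⊢
  have hese : e * s * e ∈ T := by
    have h1 := (offDiagonal_mem hT he b).1
    have h2 := (offDiagonal_mem hT he (a * e * s)).2
    have h3 := T.mul_mem h1 h2
    have h4 : (1 - e) * (1 - e) * a = a := by
      have h5 : (1 - e) * a = a := by rw [sub_mul, ha, one_mul, sub_zero]
      rw [mul_assoc, h5, h5]
    have h6 : e * b * (1 - e) * ((1 - e) * (a * e * s) * e) = e * s * e := by
      calc e * b * (1 - e) * ((1 - e) * (a * e * s) * e)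
          = e * b * ((1 - e) * (1 - e) * a) * e * s * e := by simp only [mul_assoc]
        _ = e * (b * a) * e * s * e := by rw [h4]; simp only [mul_assoc]
        _ = e * s * e := by rw [← he', he, he]
    rwa [h6] at h3
  constructor
  · have := T.add_mem hese (offDiagonal_mem hT he s).1
    rwa [← mul_add, add_sub_cancel, mul_one] at this
  · have := T.add_mem hese (offDiagonal_mem hT he s).2
    rwa [← add_mul, ← add_mul, add_sub_cancel, one_mul] at this

end Ring

section Subring

variable {T : Subring (Module.End A M)}

theorem singularIdeal_le (hM : IsAutomorphismInvariant A M) (hT : ∀ u, IsUnit u → u ∈ T)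
    {z : Module.End A M} (hz : z ∈ singularIdeal A M) : z ∈ T := by
  simpa using T.sub_mem (hT _ (isUnit_one_add hM hz)) T.one_mem

theorem corner_mem_end (hM : IsAutomorphismInvariant A M) (hT : ∀ u, IsUnit u → u ∈ T)
    {a b : Module.End A M} (he : b * a * (b * a) - b * a ∈ singularIdeal A M)
    (ha : b * a * a ∈ singularIdeal A M) (s : Module.End A M) :
    b * a * s ∈ T ∧ s * (b * a) ∈ T := by
  let π := Ideal.Quotient.mk (singularIdeal A M)
  have lift : ∀ c, π c ∈ T.map π → c ∈ T := by
    rintro c ⟨d, hd, hdc⟩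
    have := singularIdeal_le hM hT (Ideal.Quotient.mk_eq_mk_iff_sub_mem _ _ |>.1 hdc)
    simpa using T.sub_mem hd this
  have hT' : ∀ u, IsUnit u → u ∈ T.map π := by
    intro u hu
    obtain ⟨g, rfl⟩ := Ideal.Quotient.mk_surjective u
    exact ⟨g, hT g (isUnit_of_isUnit_mk hM hu), rfl⟩
  have h := corner_mem hT' (a := π a) (b := π b)
    (by simp only [← map_mul]; exact (Ideal.Quotient.mk_eq_mk_iff_sub_mem _ _).2 he)
    (by simp only [← map_mul]; exact Ideal.Quotient.eq_zero_iff_mem.2 ha) (π s)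
  exact ⟨lift _ (by simpa only [map_mul] using h.1), lift _ (by simpa only [map_mul] using h.2)⟩

/-- To realise an endomorphism `a` on `N` by an element of `T`, it suffices to do so on an
essential submodule of `N`. -/
theorem exists_mem_of_essential (hM : IsAutomorphismInvariant A M)
    (hT : ∀ u, IsUnit u → u ∈ T) {N N₂ : Submodule A M} (hle : N₂ ≤ N)
    (hess : IsEssentialIn N₂ N) (a : Module.End A M) {g : Module.End A M} (hg : g ∈ T)
    (hga : ∀ x ∈ N₂, g x = a x) : ∃ g ∈ T, ∀ x ∈ N, g x = a x := by
  obtain ⟨C, -, hd, hC⟩ := exists_complement N ⊤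
  have hinj : ∀ x ∈ N, (1 + (g - a)) x ∈ C → x = 0 := by
    have hX : N ⊓ C.comap (1 + (g - a)) = ⊥ := by
      refine hess _ inf_le_left ?_
      rw [Submodule.disjoint_def]
      rintro x hx ⟨hxN, hxC⟩
      refine Submodule.disjoint_def.1 hd x hxN ?_
      simpa [hga x hx] using hxC
    exact fun x hx hx' => (Submodule.eq_bot_iff _).1 hX x ⟨hx, hx'⟩
  have hessim : IsEssentialIn (N.map (1 + (g - a)) ⊔ C) ⊤ := by
    refine (hess.sup hle hd hC).mono (sup_le_sup_right ?_ _)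
    intro x hx
    exact ⟨x, hle hx, by simp [hga x hx]⟩
  obtain ⟨u, hu, hu1, -⟩ := exists_unit hM hd hC (1 + (g - a)) hinj hessim
  refine ⟨g - (u - 1), T.sub_mem hg (T.sub_mem (hT u hu) T.one_mem), fun x hx => ?_⟩
  simp [hu1 x hx]

/-- No nonzero `X ⊕ X` embeds in `C`; the two embeddings are given by endomorphisms of `M`. -/
def IsSquareFreeIn (C : Submodule A M) : Prop :=
  ∀ (X : Submodule A M) (g h : Module.End A M), (∀ x ∈ X, g x ∈ C) → (∀ x ∈ X, h x ∈ C) →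
    (∀ x ∈ X, ∀ y ∈ X, g x + h y = 0 → x = 0 ∧ y = 0) → X = ⊥

/-- No nonzero `X` embeds in both `P` and `K`; the embeddings are given by endomorphisms
of `M`. -/
def IsOrthogonal (P K : Submodule A M) : Prop :=
  ∀ (X : Submodule A M) (g h : Module.End A M), (∀ x ∈ X, g x ∈ P) → (∀ x ∈ X, h x ∈ K) →
    (∀ x ∈ X, g x = 0 → x = 0) → (∀ x ∈ X, h x = 0 → x = 0) → X = ⊥

theorem exists_squareFree_complement (hM : IsAutomorphismInvariant A M)
    (hT : ∀ u, IsUnit u → u ∈ T) :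
    ∃ P C : Submodule A M, Disjoint P C ∧ IsEssentialIn (P ⊔ C) ⊤ ∧ IsSquareFreeIn C ∧
      ∃ p : Module.End A M, (∀ x ∈ P, p x = x) ∧ (∀ x ∈ C, p x = 0) ∧
        ∀ s, p * s ∈ T ∧ s * p ∈ T := by
  obtain ⟨G, hG, hmax⟩ := exists_maximal_pairwise (A := A)
    (fun p q : M × M => p.1 + q.2 = 0 → p = 0 ∧ q = 0) (fun _ => ⟨rfl, rfl⟩)
  let N₁ := G.map (LinearMap.fst A M M)
  let N₂ := G.map (LinearMap.snd A M M)
  obtain ⟨C, -, hd, hess⟩ := exists_complement (N₁ ⊔ N₂) ⊤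
  have m₁ : ∀ g ∈ G, g.1 ∈ N₁ := fun g hg => ⟨g, hg, rfl⟩
  have m₂ : ∀ g ∈ G, g.2 ∈ N₂ := fun g hg => ⟨g, hg, rfl⟩
  have sep : ∀ g ∈ G, ∀ h ∈ G, ∀ c ∈ C, g.1 + h.2 + c = 0 → g = 0 ∧ h = 0 := by
    intro g hg h hh c hc h0
    have hmem := Submodule.add_mem_sup (m₁ g hg) (m₂ h hh)
    refine hG g hg h hh (Submodule.disjoint_def.1 hd _ hmem ?_)
    rw [eq_neg_of_add_eq_zero_left h0]
    exact C.neg_mem hc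
  obtain ⟨a, ha, ha0⟩ := exists_extension_zero hM G (N₂ ⊔ C) (by
    intro g hg hgD
    obtain ⟨_, ⟨h, hh, rfl⟩, c, hc, hgc⟩ := Submodule.mem_sup.1 hgD
    refine (sep g hg (-h) (G.neg_mem hh) (-c) (C.neg_mem hc) ?_).1
    rw [← hgc]
    simp) (fun g hg => Submodule.mem_sup_left (m₂ g hg))
  obtain ⟨b, hb, hb0⟩ := exists_extension_zero hM
    (G.map (LinearEquiv.prodComm A M M).toLinearMap) (N₁ ⊔ C) (by
    rintro _ ⟨h, hh, rfl⟩ hgD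
    obtain ⟨_, ⟨g, hg, rfl⟩, c, hc, hgc⟩ := Submodule.mem_sup.1 hgD
    have : h = 0 := by
      refine (sep (-g) (G.neg_mem hg) h hh (-c) (C.neg_mem hc) ?_).2
      have hgc' : g.1 + c = h.2 := hgc
      rw [← hgc']
      simp
    simp [this]) (by
    rintro _ ⟨h, hh, rfl⟩
    exact Submodule.mem_sup_left (m₁ h hh))
  have a₂ : ∀ g ∈ G, a g.2 = 0 := fun g hg => ha0 _ (Submodule.mem_sup_left (m₂ g hg))
  have aC : ∀ c ∈ C, a c = 0 := fun c hc => ha0 _ (Submodule.mem_sup_right hc)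
  have b₁ : ∀ g ∈ G, b g.1 = 0 := fun g hg => hb0 _ (Submodule.mem_sup_left (m₁ g hg))
  have bC : ∀ c ∈ C, b c = 0 := fun c hc => hb0 _ (Submodule.mem_sup_right hc)
  have b₂ : ∀ g ∈ G, b g.2 = g.1 := fun g hg => hb _ ⟨g, hg, rfl⟩
  have sing : ∀ z : Module.End A M, (∀ g ∈ G, z g.1 = 0) → (∀ g ∈ G, z g.2 = 0) →
      (∀ c ∈ C, z c = 0) → z ∈ singularIdeal A M := by
    intro z h1 h2 h3
    refine hess.mono (sup_le (sup_le ?_ ?_) ?_)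
    · rintro _ ⟨g, hg, rfl⟩
      exact h1 g hg
    · rintro _ ⟨g, hg, rfl⟩
      exact h2 g hg
    · exact h3
  have hba := corner_mem_end hM hT (a := a) (b := b)
    (sing _ (fun g hg => by simp [ha g hg, b₂ g hg]) (fun g hg => by simp [a₂ g hg])
      (fun c hc => by simp [aC c hc]))
    (sing _ (fun g hg => by simp [ha g hg, a₂ g hg]) (fun g hg => by simp [a₂ g hg])
      (fun c hc => by simp [aC c hc]))
  have hab := corner_mem_end hM hT (a := b) (b := a)
    (sing _ (fun g hg => by simp [b₁ g hg]) (fun g hg => by simp [b₂ g hg, ha g hg])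
      (fun c hc => by simp [bC c hc]))
    (sing _ (fun g hg => by simp [b₁ g hg]) (fun g hg => by simp [b₂ g hg, b₁ g hg])
      (fun c hc => by simp [bC c hc]))
  refine ⟨N₁ ⊔ N₂, C, hd, hess, ?_, b * a + a * b, ?_, ?_, ?_⟩
  · intro X g h hg hh hX
    have hle : G ⊔ X.map (LinearMap.prod g h) ≤ G := by
      refine hmax ?_ le_sup_left
      intro _ hpX _ hqX hpq
      obtain ⟨p, hp, _, ⟨x, hx, rfl⟩, rfl⟩ := Submodule.mem_sup.1 hpX
      obtain ⟨q, hq, _, ⟨y, hy, rfl⟩, rfl⟩ := Submodule.mem_sup.1 hqX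
      have hpq' : p.1 + g x + (q.2 + h y) = 0 := hpq
      have h0 : p.1 + q.2 + (g x + h y) = 0 := by rw [← hpq']; abel
      obtain ⟨rfl, rfl⟩ := sep p hp q hq _ (C.add_mem (hg x hx) (hh y hy)) h0
      obtain ⟨rfl, rfl⟩ := hX x hx y hy (by simpa using h0)
      simp
    rw [Submodule.eq_bot_iff]
    intro x hx
    have hxG : (g x, h x) ∈ G := hle (Submodule.mem_sup_right ⟨x, hx, rfl⟩)
    have h0 := (sep _ hxG 0 G.zero_mem (-g x) (C.neg_mem (hg x hx)) (by simp)).1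
    have hgx : g x = 0 := congrArg Prod.fst h0
    exact (hX x hx 0 X.zero_mem (by simp [hgx])).1
  · intro x hx
    obtain ⟨_, ⟨g, hg, rfl⟩, _, ⟨h, hh, rfl⟩, rfl⟩ := Submodule.mem_sup.1 hx
    simp [ha g hg, b₂ g hg, b₁ g hg, a₂ h hh, b₂ h hh, ha h hh]
  · intro x hx
    simp [aC x hx, bC x hx]
  · intro s
    rw [add_mul, mul_add]
    exact ⟨T.add_mem (hba s).1 (hab s).1, T.add_mem (hba s).2 (hab s).2⟩

theorem exists_orthogonal_squareFree (hM : IsAutomorphismInvariant A M)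
    (hT : ∀ u, IsUnit u → u ∈ T) :
    ∃ P K : Submodule A M, Disjoint P K ∧ IsEssentialIn (P ⊔ K) ⊤ ∧ IsSquareFreeIn K ∧
      IsOrthogonal P K ∧
      ∃ p : Module.End A M, (∀ x ∈ P, p x = x) ∧ (∀ x ∈ K, p x = 0) ∧
        ∀ s, p * s ∈ T ∧ s * p ∈ T := by
  obtain ⟨P, C, hd, hess, hsf, p, hpP, hpC, hpT⟩ := exists_squareFree_complement hM hT
  rw [Submodule.disjoint_def] at hd
  obtain ⟨H, hH, hmax⟩ := exists_maximal_pairwise (A := A)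
    (fun p _ : M × M => p.1 ∈ C ∧ p.2 ∈ P ∧ (p.1 = 0 → p = 0) ∧ (p.2 = 0 → p = 0))
    ⟨C.zero_mem, P.zero_mem, fun _ => rfl, fun _ => rfl⟩
  have hHC : ∀ g ∈ H, g.1 ∈ C := fun g hg => (hH g hg g hg).1
  have hHP : ∀ g ∈ H, g.2 ∈ P := fun g hg => (hH g hg g hg).2.1
  have hH1 : ∀ g ∈ H, g.1 = 0 → g = 0 := fun g hg => (hH g hg g hg).2.2.1
  have hH2 : ∀ g ∈ H, g.2 = 0 → g = 0 := fun g hg => (hH g hg g hg).2.2.2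
  let L := H.map (LinearMap.fst A M M)
  let L' := H.map (LinearMap.snd A M M)
  have mL : ∀ g ∈ H, g.1 ∈ L := fun g hg => ⟨g, hg, rfl⟩
  have hLC : L ≤ C := by
    rintro _ ⟨g, hg, rfl⟩
    exact hHC g hg
  obtain ⟨K, hKC, hLK, hLKess⟩ := exists_complement L C
  rw [Submodule.disjoint_def] at hLK
  obtain ⟨a, ha, ha0⟩ := exists_extension_zero hM H (P ⊔ K) (by
    intro g hg hgD
    obtain ⟨q, hq, k, hk, hgk⟩ := Submodule.mem_sup.1 hgD
    have hq0 : q = 0 := hd q hq (by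
      rw [eq_sub_of_add_eq hgk]
      exact C.sub_mem (hHC g hg) (hKC hk))
    subst hq0
    rw [zero_add] at hgk
    exact hH1 g hg (hLK _ (mL g hg) (hgk ▸ hk))) (fun g hg => Submodule.mem_sup_left (hHP g hg))
  obtain ⟨b, hb, -⟩ := exists_extension_zero hM
    (H.map (LinearEquiv.prodComm A M M).toLinearMap) C (by
    rintro _ ⟨g, hg, rfl⟩ hgC
    simp [hH2 g hg (hd _ (hHP g hg) hgC)]) (by
    rintro _ ⟨g, hg, rfl⟩
    exact hHC g hg)
  have aP : ∀ x ∈ P, a x = 0 := fun x hx => ha0 _ (Submodule.mem_sup_left hx)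
  have aK : ∀ x ∈ K, a x = 0 := fun x hx => ha0 _ (Submodule.mem_sup_right hx)
  have b₂ : ∀ g ∈ H, b g.2 = g.1 := fun g hg => hb _ ⟨g, hg, rfl⟩
  have hess' : IsEssentialIn (P ⊔ L ⊔ K) ⊤ := by
    have := hLKess.sup (sup_le hLC hKC) (Submodule.disjoint_def.2 hd).symm
      (by rwa [sup_comm] at hess)
    rwa [sup_comm, ← sup_assoc] at this
  have sing : ∀ z : Module.End A M, (∀ x ∈ P, z x = 0) → (∀ g ∈ H, z g.1 = 0) →
      (∀ x ∈ K, z x = 0) → z ∈ singularIdeal A M := by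
    intro z h1 h2 h3
    refine hess'.mono (sup_le (sup_le h1 ?_) h3)
    rintro _ ⟨g, hg, rfl⟩
    exact h2 g hg
  have hba := corner_mem_end hM hT (a := a) (b := b)
    (sing _ (fun x hx => by simp [aP x hx]) (fun g hg => by simp [ha g hg, b₂ g hg])
      (fun x hx => by simp [aK x hx]))
    (sing _ (fun x hx => by simp [aP x hx]) (fun g hg => by simp [ha g hg, aP _ (hHP g hg)])
      (fun x hx => by simp [aK x hx]))
  refine ⟨P ⊔ L, K, ?_, hess', ?_, ?_, p + b * a, ?_, ?_, ?_⟩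
  · rw [Submodule.disjoint_def]
    intro x hx hxK
    obtain ⟨q, hq, l, hl, rfl⟩ := Submodule.mem_sup.1 hx
    have hq0 : q = 0 := hd q hq (by
      simpa using C.sub_mem (hKC hxK) (hLC hl))
    subst hq0
    rw [zero_add] at hxK ⊢
    exact hLK l hl hxK
  · exact fun X g h hg hh => hsf X g h (fun x hx => hKC (hg x hx)) (fun x hx => hKC (hh x hx))
  · intro X g h hg hh hg0 hh0
    have sepLK : ∀ x ∈ L, ∀ y ∈ K, x + y = 0 → x = 0 ∧ y = 0 := by
      intro x hx y hy hxy
      have hx0 : x = 0 := hLK x hx (by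
        rw [eq_neg_of_add_eq_zero_left hxy]
        exact K.neg_mem hy)
      exact ⟨hx0, by simpa [hx0] using hxy⟩
    have hX₁ : X ⊓ L.comap g = ⊥ := by
      refine hsf _ g h (fun x hx => hLC hx.2) (fun x hx => hKC (hh x hx.1)) ?_
      intro x hx y hy hxy
      obtain ⟨h1, h2⟩ := sepLK _ hx.2 _ (hh y hy.1) hxy
      exact ⟨hg0 x hx.1 h1, hh0 y hy.1 h2⟩
    rw [Submodule.eq_bot_iff] at hX₁
    have hqP : ∀ x ∈ X, (p * g) x ∈ P := by
      intro x hx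
      obtain ⟨q, hq, l, hl, hql⟩ := Submodule.mem_sup.1 (hg x hx)
      rw [Module.End.mul_apply, ← hql, map_add, hpP q hq, hpC l (hLC hl), add_zero]
      exact hq
    have hq0 : ∀ x ∈ X, (p * g) x = 0 → x = 0 := by
      intro x hx h0
      obtain ⟨q, hq, l, hl, hql⟩ := Submodule.mem_sup.1 (hg x hx)
      rw [Module.End.mul_apply, ← hql, map_add, hpP q hq, hpC l (hLC hl), add_zero] at h0
      refine hX₁ x ⟨hx, ?_⟩
      change g x ∈ L
      rw [← hql, h0, zero_add]
      exact hl
    have hX₂ : X ⊓ L'.comap (p * g) = ⊥ := by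
      have key : ∀ x ∈ X ⊓ L'.comap (p * g), (b * (p * g)) x ∈ L ∧
          ((b * (p * g)) x = 0 → x = 0) := by
        rintro x ⟨hx, k, hk, hkx⟩
        have hkx' : k.2 = (p * g) x := hkx
        rw [Module.End.mul_apply, ← hkx', b₂ k hk]
        refine ⟨mL k hk, fun h0 => hq0 x hx ?_⟩
        rw [← hkx', hH1 k hk h0]
        rfl
      refine hsf _ (b * (p * g)) h (fun x hx => hLC (key x hx).1)
        (fun x hx => hKC (hh x hx.1)) ?_
      intro x hx y hy hxy
      obtain ⟨h1, h2⟩ := sepLK _ (key x hx).1 _ (hh y hy.1) hxy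
      exact ⟨(key x hx).2 h1, hh0 y hy.1 h2⟩
    rw [Submodule.eq_bot_iff] at hX₂
    have hle : H ⊔ X.map (LinearMap.prod h (p * g)) ≤ H := by
      refine hmax ?_ le_sup_left
      intro _ hkX _ _
      obtain ⟨k, hk, _, ⟨x, hx, rfl⟩, rfl⟩ := Submodule.mem_sup.1 hkX
      refine ⟨C.add_mem (hHC k hk) (hKC (hh x hx)), P.add_mem (hHP k hk) (hqP x hx), ?_, ?_⟩
      · intro h0
        obtain ⟨h1, h2⟩ := sepLK _ (mL k hk) _ (hh x hx) h0
        simp [hH1 k hk h1, hh0 x hx h2]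
      · intro h0
        have h0' : k.2 + (p * g) x = 0 := h0
        have hx0 : x = 0 := by
          refine hX₂ x ⟨hx, ?_⟩
          change (p * g) x ∈ L'
          rw [eq_neg_of_add_eq_zero_right h0']
          exact L'.neg_mem ⟨k, hk, rfl⟩
        subst hx0
        simp [hH2 k hk (by simpa using h0')]
    rw [Submodule.eq_bot_iff]
    intro x hx
    have hxH : (h x, (p * g) x) ∈ H := hle (Submodule.mem_sup_right ⟨x, hx, rfl⟩)
    exact hh0 x hx (hLK _ (mL _ hxH) (hh x hx))
  · intro x hx
    obtain ⟨q, hq, _, ⟨g, hg, rfl⟩, rfl⟩ := Submodule.mem_sup.1 hx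
    simp [hpP q hq, aP q hq, hpC _ (hHC g hg), ha g hg, b₂ g hg]
  · intro x hx
    simp [hpC x (hKC hx), aK x hx]
  · intro s
    rw [add_mul, mul_add]
    exact ⟨T.add_mem (hpT s).1 (hba s).1, T.add_mem (hpT s).2 (hba s).2⟩

/-- Over an automorphism-invariant module, an endomorphism which is injective on `N` agrees
on `N` with an element of any given subring containing all automorphisms. -/
theorem exists_mem_subring (hM : IsAutomorphismInvariant A M) (hT : ∀ u, IsUnit u → u ∈ T)
    (N : Submodule A M) (a : Module.End A M) (ha : ∀ x ∈ N, a x = 0 → x = 0) :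
    ∃ g ∈ T, ∀ x ∈ N, g x = a x := by
  obtain ⟨P, K, hd, hess, hsf, horth, p, hpP, hpK, hpT⟩ := exists_orthogonal_squareFree hM hT
  have hdis := Submodule.disjoint_def.1 hd
  obtain ⟨e, he⟩ : ∃ e, e = 1 - p := ⟨_, rfl⟩
  have heP : ∀ x ∈ P, e x = 0 := fun x hx => by simp [he, hpP x hx]
  have heK : ∀ x ∈ K, e x = x := fun x hx => by simp [he, hpK x hx]
  let f : Module.End A M := e * a
  have hf_inj : ∀ x ∈ N ⊓ K, f x = 0 → x = 0 := by
    have hX : N ⊓ K ⊓ LinearMap.ker f = ⊥ := by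
      refine hess.comap a _ le_top ?_
      rw [disjoint_comm, disjoint_iff]
      refine horth _ a 1 ?_ (fun x hx => hx.1.1.2) (fun x hx => ha x hx.1.1.1)
        (fun x _ h => h)
      rintro x ⟨⟨-, hx⟩, hax⟩
      obtain ⟨q, hq, k, hk, hqk⟩ := Submodule.mem_sup.1 hax
      have hk0 : k = 0 := by
        have h0 : e (a x) = 0 := hx
        rwa [← hqk, map_add, heP q hq, heK k hk, zero_add] at h0
      rw [← hqk, hk0, add_zero]
      exact hq
    exact fun x hx h0 => (Submodule.eq_bot_iff _).1 hX x ⟨hx, h0⟩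
  let N₁ := N ⊓ K ⊓ K.comap f
  have hN₁ : IsEssentialIn N₁ (N ⊓ K) := by
    intro J hJ hJd
    refine hess.comap f J le_top ?_
    rw [disjoint_comm, disjoint_iff]
    refine horth _ (p * f) 1 ?_ (fun x hx => (hJ hx.1).2) ?_ (fun x _ h => h)
    · rintro x ⟨-, hfx⟩
      obtain ⟨q, hq, k, hk, hqk⟩ := Submodule.mem_sup.1 hfx
      rw [Module.End.mul_apply, ← hqk, map_add, hpP q hq, hpK k hk, add_zero]
      exact hq
    · rintro x ⟨hxJ, hfx⟩ h0
      obtain ⟨q, hq, k, hk, hqk⟩ := Submodule.mem_sup.1 hfx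
      rw [Module.End.mul_apply, ← hqk, map_add, hpP q hq, hpK k hk, add_zero] at h0
      refine Submodule.disjoint_def.1 hJd x ⟨hJ hxJ, ?_⟩ hxJ
      change f x ∈ K
      rw [← hqk, h0, zero_add]
      exact hk
  obtain ⟨K₂, hK₂, hNK, hNKess⟩ := exists_complement N₁ K
  have hNK' := Submodule.disjoint_def.1 hNK
  have hN₁K : N₁ ≤ K := fun x hx => hx.1.2
  have hsf' : ∀ X ≤ N₁, (∀ x ∈ X, ∀ y ∈ X, x + f y = 0 → x = 0 ∧ y = 0) → X = ⊥ :=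
    fun X hX h => hsf X 1 f (fun x hx => hN₁K (hX hx)) (fun x hx => (hX hx).2) h
  have hfK₂ : ∀ x ∈ N₁, f x ∈ K₂ → x = 0 := by
    have hX : N₁ ⊓ K₂.comap f = ⊥ := by
      refine hsf' _ inf_le_left ?_
      intro x hx y hy hxy
      have hx0 : x = 0 := by
        refine hNK' x hx.1 ?_
        rw [eq_neg_of_add_eq_zero_left hxy]
        exact K₂.neg_mem hy.2
      subst hx0
      exact ⟨rfl, hf_inj y hy.1.1 (by simpa using hxy)⟩
    exact fun x hx hx' => (Submodule.eq_bot_iff _).1 hX x ⟨hx, hx'⟩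
  have hfNK : IsEssentialIn (N₁.map f ⊔ K₂) K := by
    intro J hJ hJd
    have hJd' := Submodule.disjoint_def.1 hJd
    have hX : N₁ ⊓ (J ⊔ K₂) = ⊥ := by
      refine hsf' _ inf_le_left ?_
      intro x hx y hy hxy
      have hy0 : y = 0 := by
        have hfy : f y ∈ J ⊔ K₂ := by
          rw [eq_neg_of_add_eq_zero_right hxy]
          exact (J ⊔ K₂).neg_mem hx.2
        obtain ⟨j, hj, k, hk, hjk⟩ := Submodule.mem_sup.1 hfy
        have hj0 : j = 0 := by
          refine hJd' j ?_ hj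
          rw [eq_sub_of_add_eq hjk]
          exact Submodule.sub_mem _ (Submodule.mem_sup_left ⟨y, hy.1, rfl⟩)
            (Submodule.mem_sup_right hk)
        refine hfK₂ y hy.1 ?_
        rw [← hjk, hj0, zero_add]
        exact hk
      subst hy0
      exact ⟨by simpa using hxy, rfl⟩
    refine hNKess J hJ ?_
    rw [Submodule.disjoint_def]
    intro j hj hjJ
    obtain ⟨x, hx, k, hk, rfl⟩ := Submodule.mem_sup.1 hj
    have hx0 : x = 0 := by
      refine (Submodule.eq_bot_iff _).1 hX x ⟨hx, ?_⟩
      simpa using Submodule.sub_mem _ (Submodule.mem_sup_left hjJ)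
        (Submodule.mem_sup_right (S := J) hk)
    subst hx0
    rw [zero_add] at hjJ ⊢
    exact hJd' k (Submodule.mem_sup_right hk) hjJ
  have hess' : IsEssentialIn (K ⊔ P) ⊤ := by rwa [sup_comm] at hess
  have hsep : ∀ x ∈ K, x ∈ K₂ ⊔ P → x ∈ K₂ := by
    intro x hx hx'
    obtain ⟨k, hk, q, hq, rfl⟩ := Submodule.mem_sup.1 hx'
    have hq0 : q = 0 := hdis q hq (by simpa using K.sub_mem hx (hK₂ hk))
    rwa [hq0, add_zero]
  obtain ⟨u, hu, huN, -⟩ := exists_unit hM (N := N₁) (D := K₂ ⊔ P)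
    (Submodule.disjoint_def.2 fun x hx hx' => hNK' x hx (hsep x (hN₁K hx) hx'))
    (by
      rw [← sup_assoc]
      exact hNKess.sup (sup_le hN₁K hK₂) hd.symm hess') f
    (fun x hx hx' => hfK₂ x hx (hsep _ hx.2 hx'))
    (by
      rw [← sup_assoc]
      refine hfNK.sup (sup_le ?_ hK₂) hd.symm hess'
      rintro _ ⟨x, hx, rfl⟩
      exact hx.2)
  have heT : e ∈ T := by
    have h1 := (hpT 1).1
    rw [mul_one] at h1
    rw [he]
    exact T.sub_mem T.one_mem h1
  have hcorner : a - e * a * e ∈ T := by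
    have : a - e * a * e = p * a + (a - p * a) * p := by
      rw [he]
      noncomm_ring
    rw [this]
    exact T.add_mem (hpT a).1 (hpT _).2
  refine exists_mem_of_essential hM hT (N₂ := N₁ ⊔ (N ⊓ P))
    (sup_le (fun x hx => hx.1.1) inf_le_left) ?_ a
    (g := a - e * a * e + e * u * e)
    (T.add_mem hcorner (T.mul_mem (T.mul_mem heT (hT u hu)) heT)) ?_
  · intro J hJ hJd
    have hJd' := Submodule.disjoint_def.1 hJd
    refine hess J le_top ?_
    rw [disjoint_comm, disjoint_iff]
    have hJK : ∀ x ∈ J, x ∈ K → x = 0 := by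
      have : J ⊓ K = ⊥ := by
        refine hN₁ _ (inf_le_inf_right _ hJ) ?_
        exact hJd.mono le_sup_left inf_le_left
      exact fun x hx hx' => (Submodule.eq_bot_iff _).1 this x ⟨hx, hx'⟩
    refine horth _ p e ?_ ?_ ?_ ?_
    · rintro x ⟨-, hx⟩
      obtain ⟨q, hq, k, hk, rfl⟩ := Submodule.mem_sup.1 hx
      rwa [map_add, hpP q hq, hpK k hk, add_zero]
    · rintro x ⟨-, hx⟩
      obtain ⟨q, hq, k, hk, rfl⟩ := Submodule.mem_sup.1 hx
      rwa [map_add, heP q hq, heK k hk, zero_add]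
    · rintro x ⟨hxJ, hx⟩ h0
      obtain ⟨q, hq, k, hk, rfl⟩ := Submodule.mem_sup.1 hx
      rw [map_add, hpP q hq, hpK k hk, add_zero] at h0
      exact hJK _ hxJ (by rwa [h0, zero_add])
    · rintro x ⟨hxJ, hx⟩ h0
      obtain ⟨q, hq, k, hk, rfl⟩ := Submodule.mem_sup.1 hx
      rw [map_add, heP q hq, heK k hk, zero_add] at h0
      subst h0
      rw [add_zero] at hxJ ⊢
      exact hJd' q (Submodule.mem_sup_right ⟨hJ hxJ, hq⟩) hxJ
  · intro x hx
    obtain ⟨y, hy, q, hq, rfl⟩ := Submodule.mem_sup.1 hx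
    have h1 : e y = y := heK y (hN₁K hy)
    have h2 : e q = 0 := heP q hq.2
    have h3 : e (f y) = f y := heK _ hy.2
    have h4 : e (a y) = f y := rfl
    simp [h1, h2, huN y hy, h3, h4]

end Subring

/-- A submodule of an automorphism-invariant module is automorphism-invariant if every
essential submodule is stable under all automorphisms. -/
theorem submodule (hM : IsAutomorphismInvariant A M)
    (hunit : ∀ I : Submodule A M, IsEssentialIn I ⊤ →
      ∀ u : Module.End A M, IsUnit u → ∀ x ∈ I, u x ∈ I) (I : Submodule A M) :
    IsAutomorphismInvariant A I := by
  intro N f hf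
  obtain ⟨K, -, hd, hess⟩ := exists_complement I ⊤
  have hd' := Submodule.disjoint_def.1 hd
  let T : Subring (Module.End A M) :=
    { carrier := {g | ∀ x ∈ I ⊔ K, g x ∈ I ⊔ K}
      mul_mem' := fun ha hb x hx => ha _ (hb x hx)
      one_mem' := fun x hx => hx
      add_mem' := fun ha hb x hx => Submodule.add_mem _ (ha x hx) (hb x hx)
      zero_mem' := fun x _ => Submodule.zero_mem _
      neg_mem' := fun ha x hx => Submodule.neg_mem _ (ha x hx) }
  have hfM : Function.Injective (I.subtype ∘ₗ f) := I.injective_subtype.comp hf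
  have hiM : Function.Injective (I.subtype ∘ₗ N.subtype) :=
    I.injective_subtype.comp N.injective_subtype
  obtain ⟨a, ha⟩ := exists_extension hM _ _ hiM hfM
  obtain ⟨g, hgT, hg⟩ := exists_mem_subring (T := T) hM (fun u hu => hunit _ hess u hu)
    (LinearMap.range (I.subtype ∘ₗ N.subtype)) a (by
      rintro _ ⟨x, rfl⟩ h0
      rw [ha] at h0
      rw [hfM (h0.trans (map_zero _).symm), map_zero])
  have hi : Function.Injective (I.subtype.coprod K.subtype) := by
    rw [← LinearMap.ker_eq_bot, LinearMap.ker_coprod_of_disjoint_range]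
    · simp
    · simpa using hd
  let φ := LinearEquiv.ofInjective _ hi
  have hrange : LinearMap.range (I.subtype.coprod K.subtype) = I ⊔ K := by
    rw [LinearMap.range_coprod]
    simp
  let gI : I →ₗ[A] LinearMap.range (I.subtype.coprod K.subtype) :=
    (g ∘ₗ I.subtype).codRestrict _ fun x => by
      rw [hrange]
      exact hgT _ (Submodule.mem_sup_left x.2)
  refine ⟨LinearMap.fst A I K ∘ₗ φ.symm.toLinearMap ∘ₗ gI, fun n => ?_⟩
  have hgn : gI n = φ (f n, 0) := by
    apply Subtype.ext
    have h1 : g (n : I) = a (n : I) := hg _ ⟨n, rfl⟩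
    have h2 : a (n : I) = f n := ha n
    change g (n : I) = (f n : M) + ((0 : K) : M)
    rw [h1, h2, ZeroMemClass.coe_zero, add_zero]
  simp [hgn]

/-- An essential automorphism-invariant submodule is stable under all endomorphisms which are
injective on it. -/
theorem apply_mem {I : Submodule A M} (hess : IsEssentialIn I ⊤)
    (hI : IsAutomorphismInvariant A I) {u : Module.End A M} (hu : ∀ x ∈ I, u x = 0 → x = 0) :
    ∀ x ∈ I, u x ∈ I := by
  let N : Submodule A I := I.comap (u ∘ₗ I.subtype)
  let f : N →ₗ[A] I := (u ∘ₗ I.subtype ∘ₗ N.subtype).codRestrict I fun x => x.2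
  have hf : Function.Injective f := by
    rw [← LinearMap.ker_eq_bot, LinearMap.ker_eq_bot']
    intro x hx
    have h0 : u (x : I) = 0 := congrArg Subtype.val hx
    exact Subtype.ext (Subtype.ext (hu _ (x : I).2 h0))
  obtain ⟨g, hg⟩ := hI N f hf
  have hg' : ∀ x : I, u x ∈ I → (g x : M) = u x := fun x hx => congrArg Subtype.val (hg ⟨x, hx⟩)
  have hrange : LinearMap.range (I.subtype ∘ₗ g - u ∘ₗ I.subtype) = ⊥ := by
    refine hess _ le_top ?_
    rw [Submodule.disjoint_def]
    rintro _ hy ⟨x, rfl⟩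
    have hy' : (g x : M) - u x ∈ I := hy
    have hux : u x ∈ I := by simpa using I.sub_mem (g x).2 hy'
    change (g x : M) - u x = 0
    rw [hg' x hux, sub_self]
  intro x hx
  have h0 : (g ⟨x, hx⟩ : M) - u x = 0 :=
    (Submodule.eq_bot_iff _).1 hrange _ ⟨⟨x, hx⟩, rfl⟩
  rw [← sub_eq_zero.1 h0]
  exact (g ⟨x, hx⟩).2

theorem of_top (h : IsAutomorphismInvariant A (⊤ : Submodule A M)) :
    IsAutomorphismInvariant A M := by
  intro N f hf
  let e : (⊤ : Submodule A M) ≃ₗ[A] M := Submodule.topEquiv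
  obtain ⟨g, hg⟩ := exists_extension h (e.symm.toLinearMap ∘ₗ N.subtype)
    (e.symm.toLinearMap ∘ₗ f) (e.symm.injective.comp N.injective_subtype)
    (e.symm.injective.comp hf)
  refine ⟨e.toLinearMap ∘ₗ g ∘ₗ e.symm.toLinearMap, fun n => ?_⟩
  have := hg n
  simp only [LinearMap.comp_apply, LinearEquiv.coe_coe, Submodule.subtype_apply] at this ⊢
  rw [this, LinearEquiv.apply_symm_apply]

end AutomorphismInvariant

/-- characterizations of right `a`-rings. -/
theorem rightARing_tfae (R : Type*) [Ring R] :
    List.TFAE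
      [IsRightARing R,
       ∀ I : Submodule Rᵐᵒᵖ R, IsEssentialRightIdeal R I → IsAutomorphismInvariant Rᵐᵒᵖ I,
       IsAutomorphismInvariant Rᵐᵒᵖ R ∧
         ∀ I : Submodule Rᵐᵒᵖ R, IsEssentialRightIdeal R I →
           ∀ u : Rˣ, ∀ x ∈ I, (u : R) * x ∈ I] := by
  have hess : ∀ I : Submodule Rᵐᵒᵖ R,
      IsEssentialRightIdeal R I ↔ AutomorphismInvariant.IsEssentialIn I ⊤ := fun I =>
    ⟨fun h J _ hJ => h J hJ.eq_bot, fun h J hJ => h J le_top (disjoint_iff.2 hJ)⟩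
  tfae_have 1 → 2 := fun h I _ => h I
  tfae_have 2 → 3 := by
    intro h
    refine ⟨AutomorphismInvariant.of_top (h ⊤ fun J hJ => by simpa using hJ), ?_⟩
    intro I hI u
    refine AutomorphismInvariant.apply_mem ((hess I).1 hI) (h I hI)
      (u := LinearMap.mulLeft Rᵐᵒᵖ (u : R)) ?_
    intro x _ hx
    exact (Units.mul_right_eq_zero u).1 hx
  tfae_have 3 → 1 := by
    rintro ⟨hR, hI⟩
    refine AutomorphismInvariant.submodule hR ?_
    intro I hI' g hg x hx
    have apply_eq : ∀ (k : Module.End Rᵐᵒᵖ R) (y : R), k y = k 1 * y := by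
      intro k y
      simpa using k.map_smul (MulOpposite.op y) 1
    obtain ⟨g, rfl⟩ := hg
    have h1 : g.1 1 * (g⁻¹).1 1 = 1 := by
      rw [← apply_eq, ← Module.End.mul_apply, Units.mul_inv, Module.End.one_apply]
    have h2 : (g⁻¹).1 1 * g.1 1 = 1 := by
      rw [← apply_eq, ← Module.End.mul_apply, Units.inv_mul, Module.End.one_apply]
    rw [apply_eq]
    exact hI I ((hess I).2 hI') ⟨_, _, h1, h2⟩ x hx
  tfae_finish
end

section
/- Let R = S × T be a direct product of rings S and T. Then R is a right a-ring if and only if both S and T are right a-rings. -/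
/-- A ring factor `S` of `R`: a ring projection `φ : R → S` with an additive section `ι`
identifying `S` with the ideal generated by the idempotent `ι 1`. -/
structure IsRingFactor {R S : Type*} [Ring R] [Ring S] (φ : R →+* S) (ι : S →+ R) : Prop where
  proj_incl : ∀ s, φ (ι s) = s
  incl_mul : ∀ s r, ι (s * φ r) = ι s * r
  incl_proj : ∀ r, ι (φ r) = r * ι 1

namespace IsRingFactor

variable {R S : Type*} [Ring R] [Ring S] {φ : R →+* S} {ι : S →+ R}

theorem incl_mul_incl (h : IsRingFactor φ ι) (s t : S) : ι (s * t) = ι s * ι t := by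
  rw [← h.incl_mul, h.proj_incl]

theorem incl_proj_mem (h : IsRingFactor φ ι) (I : Submodule Rᵐᵒᵖ R) {r : R} (hr : r ∈ I) :
    ι (φ r) ∈ I := by
  rw [h.incl_proj]
  exact I.smul_mem (MulOpposite.op (ι 1)) hr

/-- The right ideal of `R` that is the image of a right ideal of the factor `S`. -/
def extend (h : IsRingFactor φ ι) (I : Submodule Sᵐᵒᵖ S) : Submodule Rᵐᵒᵖ R where
  carrier := {r | φ r ∈ I ∧ ι (φ r) = r}
  zero_mem' := by simp
  add_mem' := by
    rintro x y ⟨hx, hx'⟩ ⟨hy, hy'⟩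
    exact ⟨by rw [map_add]; exact I.add_mem hx hy, by rw [map_add, map_add, hx', hy']⟩
  smul_mem' := by
    rintro c x ⟨hx, hx'⟩
    refine ⟨?_, ?_⟩
    · rw [MulOpposite.smul_eq_mul_unop, map_mul]
      exact I.smul_mem (MulOpposite.op (φ c.unop)) hx
    · rw [MulOpposite.smul_eq_mul_unop, map_mul, h.incl_mul, hx']

/-- The right ideal of the factor `S` cut out by a right ideal of `R`. -/
def contract (h : IsRingFactor φ ι) (I : Submodule Rᵐᵒᵖ R) : Submodule Sᵐᵒᵖ S where
  carrier := {s | ι s ∈ I}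
  zero_mem' := by simp
  add_mem' := by
    intro x y hx hy
    simp only [Set.mem_ofPred_eq, map_add] at *
    exact I.add_mem hx hy
  smul_mem' := by
    intro c x hx
    simp only [Set.mem_ofPred_eq, MulOpposite.smul_eq_mul_unop, h.incl_mul_incl] at *
    exact I.smul_mem (MulOpposite.op (ι c.unop)) hx

/-- The projection of an extended right ideal onto the original one. -/
def extendProj (h : IsRingFactor φ ι) (I : Submodule Sᵐᵒᵖ S) : h.extend I →ₛₗ[φ.op] I where
  toFun x := ⟨φ x, x.2.1⟩
  map_add' _ _ := Subtype.ext (map_add φ _ _)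
  map_smul' _ _ := Subtype.ext (map_mul φ _ _)

/-- The projection of a right ideal onto its contraction. -/
def contractProj (h : IsRingFactor φ ι) (I : Submodule Rᵐᵒᵖ R) : I →ₛₗ[φ.op] h.contract I where
  toFun x := ⟨φ x, h.incl_proj_mem I x.2⟩
  map_add' _ _ := Subtype.ext (map_add φ _ _)
  map_smul' _ _ := Subtype.ext (map_mul φ _ _)

/-- The inclusion of a right ideal of the factor into its extension. -/
def extendIncl (h : IsRingFactor φ ι) (I : Submodule Sᵐᵒᵖ S) : I →+ h.extend I where
  toFun s := ⟨ι s, by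
    rw [h.proj_incl]; exact s.2, by rw [h.proj_incl]⟩
  map_zero' := Subtype.ext (map_zero ι)
  map_add' _ _ := Subtype.ext (map_add ι _ _)

/-- The inclusion of the contraction of a right ideal into that right ideal. -/
def contractIncl (h : IsRingFactor φ ι) (I : Submodule Rᵐᵒᵖ R) : h.contract I →+ I where
  toFun s := ⟨ι s, s.2⟩
  map_zero' := Subtype.ext (map_zero ι)
  map_add' _ _ := Subtype.ext (map_add ι _ _)

theorem isRightARing (h : IsRingFactor φ ι) (hR : IsRightARing R) : IsRightARing S := by
  intro I N f hf
  have incl_smul (c : Rᵐᵒᵖ) (x : I) : h.extendIncl I (φ.op c • x) = c • h.extendIncl I x :=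
    Subtype.ext (h.incl_mul x c.unop)
  have incl_smul' (c : Sᵐᵒᵖ) (x : I) :
      h.extendIncl I (c • x) = MulOpposite.op (ι c.unop) • h.extendIncl I x :=
    Subtype.ext (h.incl_mul_incl x c.unop)
  have proj_incl (x : I) : h.extendProj I (h.extendIncl I x) = x :=
    Subtype.ext (h.proj_incl x)
  have incl_proj (x : h.extend I) : h.extendIncl I (h.extendProj I x) = x :=
    Subtype.ext x.2.2
  let N' : Submodule Rᵐᵒᵖ (h.extend I) :=
    { carrier := {x | h.extendProj I x ∈ N}
      zero_mem' := by simp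
      add_mem' := fun {x y} hx hy => by
        simp only [Set.mem_ofPred_eq, map_add] at *
        exact N.add_mem hx hy
      smul_mem' := fun c x hx => by
        simp only [Set.mem_ofPred_eq, LinearMap.map_smulₛₗ] at *
        exact N.smul_mem _ hx }
  let f' : N' →ₗ[Rᵐᵒᵖ] h.extend I :=
    { toFun := fun x => h.extendIncl I (f ⟨h.extendProj I x, x.2⟩)
      map_add' := fun x y => by
        rw [← map_add, ← map_add]
        congr 2
        exact Subtype.ext (map_add (h.extendProj I) _ _)
      map_smul' := fun c x => by
        rw [RingHom.id_apply, ← incl_smul, ← map_smul]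
        congr 2
        exact Subtype.ext (LinearMap.map_smulₛₗ (h.extendProj I) _ _) }
  have hf' : Function.Injective f' := by
    intro x y hxy
    have h₁ := congrArg (h.extendProj I) hxy
    simp only [f', LinearMap.coe_mk, AddHom.coe_mk, proj_incl] at h₁
    have h₂ := congrArg (fun z => h.extendIncl I z.1) (hf h₁)
    simp only [incl_proj] at h₂
    exact Subtype.ext h₂
  obtain ⟨g, hg⟩ := hR _ N' f' hf'
  refine ⟨{ toFun := fun s => h.extendProj I (g (h.extendIncl I s))
            map_add' := fun x y => by simp only [map_add]
            map_smul' := fun c x => by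
              rw [incl_smul', map_smul, LinearMap.map_smulₛₗ]
              congr 1
              exact congrArg MulOpposite.op (h.proj_incl c.unop) }, fun n => ?_⟩
  have hn : h.extendIncl I n ∈ N' := by
    change h.extendProj I _ ∈ N
    rw [proj_incl]
    exact n.2
  have key := hg ⟨_, hn⟩
  simp only [LinearMap.coe_mk, AddHom.coe_mk] at key ⊢
  rw [key]
  simp only [f', LinearMap.coe_mk, AddHom.coe_mk, proj_incl]

/-- If the factor is a right `a`-ring, the component in that factor of an injective map
into a right ideal extends to the whole right ideal. -/
theorem exists_extension (h : IsRingFactor φ ι) (hS : IsRightARing S) (I : Submodule Rᵐᵒᵖ R)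
    (N : Submodule Rᵐᵒᵖ I) (f : N →ₗ[Rᵐᵒᵖ] I) (hf : Function.Injective f) :
    ∃ g : I →ₗ[Rᵐᵒᵖ] I, ∀ n : N, (g n : R) = ι (φ (f n : R)) := by
  have incl_smul (c : Rᵐᵒᵖ) (x : h.contract I) :
      h.contractIncl I (φ.op c • x) = c • h.contractIncl I x :=
    Subtype.ext (h.incl_mul x c.unop)
  have incl_smul' (c : Sᵐᵒᵖ) (x : h.contract I) :
      h.contractIncl I (c • x) = MulOpposite.op (ι c.unop) • h.contractIncl I x :=
    Subtype.ext (h.incl_mul_incl x c.unop)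
  have incl_injective : Function.Injective (h.contractIncl I) := by
    intro x y hxy
    have := congrArg (fun z : I => φ z) hxy
    simp only [contractIncl, AddMonoidHom.coe_mk, ZeroHom.coe_mk, h.proj_incl] at this
    exact Subtype.ext this
  have incl_proj (x : I) :
      h.contractIncl I (h.contractProj I x) = MulOpposite.op (ι 1) • x :=
    Subtype.ext (h.incl_proj x)
  have smul_incl (x : h.contract I) :
      MulOpposite.op (ι 1) • h.contractIncl I x = h.contractIncl I x := by
    rw [← incl_proj]
    exact Subtype.ext (congrArg ι (h.proj_incl x))
  let N' : Submodule Sᵐᵒᵖ (h.contract I) :=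
    { carrier := {x | h.contractIncl I x ∈ N}
      zero_mem' := by simp
      add_mem' := fun {x y} hx hy => by
        simp only [Set.mem_ofPred_eq, map_add] at *
        exact N.add_mem hx hy
      smul_mem' := fun c x hx => by
        simp only [Set.mem_ofPred_eq, incl_smul'] at *
        exact N.smul_mem _ hx }
  let f' : N' →ₗ[Sᵐᵒᵖ] h.contract I :=
    { toFun := fun x => h.contractProj I (f ⟨h.contractIncl I x, x.2⟩)
      map_add' := fun x y => by
        rw [← map_add, ← map_add]
        congr 2
        exact Subtype.ext (map_add (h.contractIncl I) _ _)
      map_smul' := fun c x => by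
        have hc : φ.op (MulOpposite.op (ι c.unop)) = c :=
          congrArg MulOpposite.op (h.proj_incl c.unop)
        conv_rhs => rw [RingHom.id_apply, ← hc, ← LinearMap.map_smulₛₗ, ← map_smul]
        congr 2
        exact Subtype.ext (incl_smul' c x) }
  have hf' : Function.Injective f' := by
    intro x y hxy
    have h₁ := congrArg (h.contractIncl I) hxy
    simp only [f', LinearMap.coe_mk, AddHom.coe_mk, incl_proj, ← map_smul] at h₁
    have h₂ := congrArg Subtype.val (hf h₁)
    simp only [Submodule.coe_smul_of_tower, smul_incl] at h₂
    exact Subtype.ext (incl_injective h₂)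
  obtain ⟨g, hg⟩ := hS _ N' f' hf'
  refine ⟨{ toFun := fun s => h.contractIncl I (g (h.contractProj I s))
            map_add' := fun x y => by simp only [map_add]
            map_smul' := fun c x => by
              rw [LinearMap.map_smulₛₗ, map_smul, incl_smul, RingHom.id_apply] }, fun n => ?_⟩
  have hn : h.contractProj I n ∈ N' := by
    change h.contractIncl I _ ∈ N
    rw [incl_proj]
    exact N.smul_mem _ n.2
  have key := hg ⟨_, hn⟩
  have hfn : f ⟨h.contractIncl I (h.contractProj I n), hn⟩ = MulOpposite.op (ι 1) • f n := by
    rw [← map_smul]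
    congr 1
    exact Subtype.ext (incl_proj n)
  have hgn : h.contractIncl I (g (h.contractProj I n)) =
      h.contractIncl I (h.contractProj I (f n)) := by
    rw [key]
    change h.contractIncl I (h.contractProj I (f ⟨h.contractIncl I (h.contractProj I n), hn⟩)) = _
    rw [hfn, ← incl_proj]
    exact Subtype.ext (congrArg ι (h.proj_incl _))
  exact congrArg Subtype.val hgn

theorem fst (S T : Type*) [Ring S] [Ring T] :
    IsRingFactor (RingHom.fst S T) (AddMonoidHom.inl S T) where
  proj_incl _ := rfl
  incl_mul s r := by ext <;> simp
  incl_proj r := by ext <;> simp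

theorem snd (S T : Type*) [Ring S] [Ring T] :
    IsRingFactor (RingHom.snd S T) (AddMonoidHom.inr S T) where
  proj_incl _ := rfl
  incl_mul s r := by ext <;> simp
  incl_proj r := by ext <;> simp

end IsRingFactor

/-- `S × T` is a right `a`-ring iff both `S` and `T` are. -/
theorem prod_isRightARing_iff (S T : Type*) [Ring S] [Ring T] :
    IsRightARing (S × T) ↔ (IsRightARing S ∧ IsRightARing T) := by
  refine ⟨fun h => ⟨(IsRingFactor.fst S T).isRightARing h, (IsRingFactor.snd S T).isRightARing h⟩,
    fun ⟨hS, hT⟩ I N f hf => ?_⟩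
  obtain ⟨g₁, hg₁⟩ := (IsRingFactor.fst S T).exists_extension hS I N f hf
  obtain ⟨g₂, hg₂⟩ := (IsRingFactor.snd S T).exists_extension hT I N f hf
  refine ⟨g₁ + g₂, fun n => Subtype.ext ?_⟩
  rw [LinearMap.add_apply, Submodule.coe_add, hg₁, hg₂]
  ext <;> simp
end

section
/- Let R be a right a-ring and let A and B be right ideals of R with A ∩ B = 0 and A ≅ B as right R-modules. Then A is a semisimple and injective right R-module, and A is nonsingular, i.e., Z(A) = 0. -/
section RelativeInjectivity

variable {S M : Type*} [Ring S] [AddCommGroup M] [Module S M]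

/-- `Q` is *`P`-injective* if every linear map from a submodule of `P` into `Q` extends to `P`. -/
def IsRelativelyInjective (S P Q : Type*) [Ring S] [AddCommGroup P] [Module S P]
    [AddCommGroup Q] [Module S Q] : Prop :=
  ∀ (N : Submodule S P) (f : N →ₗ[S] Q), ∃ g : P →ₗ[S] Q, ∀ n : N, g n = f n

theorem IsAutomorphismInvariant.of_equiv {P Q : Type*} [AddCommGroup P] [Module S P]
    [AddCommGroup Q] [Module S Q] (e : P ≃ₗ[S] Q) (h : IsAutomorphismInvariant S P) :
    IsAutomorphismInvariant S Q := by
  intro N f hf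
  let c : N.comap e.toLinearMap →ₗ[S] N :=
    e.toLinearMap.restrict (fun x hx => hx)
  have hc : Function.Injective c := fun x y hxy =>
    Subtype.ext (e.injective (congrArg Subtype.val hxy))
  obtain ⟨g, hg⟩ := h (N.comap e.toLinearMap) (e.symm.toLinearMap ∘ₗ f ∘ₗ c)
    (e.symm.injective.comp (hf.comp hc))
  refine ⟨e.toLinearMap ∘ₗ g ∘ₗ e.symm.toLinearMap, fun n => ?_⟩
  have hn : e.symm (n : Q) ∈ N.comap e.toLinearMap := by simp
  have key := hg ⟨e.symm n, hn⟩
  have hcn : c ⟨e.symm n, hn⟩ = n := Subtype.ext (e.apply_symm_apply _)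
  simp only [LinearMap.comp_apply, hcn, LinearEquiv.coe_coe] at key ⊢
  rw [key, e.apply_symm_apply]

theorem IsRelativelyInjective.of_equiv {P P' Q : Type*} [AddCommGroup P] [Module S P]
    [AddCommGroup P'] [Module S P'] [AddCommGroup Q] [Module S Q] (e : P ≃ₗ[S] P')
    (h : IsRelativelyInjective S P Q) : IsRelativelyInjective S P' Q := by
  intro N f
  let c : N.comap e.toLinearMap →ₗ[S] N :=
    e.toLinearMap.restrict (fun x hx => hx)
  obtain ⟨g, hg⟩ := h (N.comap e.toLinearMap) (f ∘ₗ c)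
  refine ⟨g ∘ₗ e.symm.toLinearMap, fun n => ?_⟩
  have hn : e.symm (n : P') ∈ N.comap e.toLinearMap := by simp
  have hcn : c ⟨e.symm n, hn⟩ = n := Subtype.ext (e.apply_symm_apply _)
  simpa [hcn] using hg ⟨e.symm n, hn⟩

theorem IsAutomorphismInvariant.isRelativelyInjective_of_prod {P Q : Type*}
    [AddCommGroup P] [Module S P] [AddCommGroup Q] [Module S Q]
    (h : IsAutomorphismInvariant S (P × Q)) : IsRelativelyInjective S P Q := by
  intro N f
  let p : N.prod (⊤ : Submodule S Q) →ₗ[S] N :=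
    (LinearMap.fst S P Q).restrict (fun x hx => hx.1)
  let F : N.prod (⊤ : Submodule S Q) →ₗ[S] P × Q :=
    (N.prod ⊤).subtype + LinearMap.inr S P Q ∘ₗ f ∘ₗ p
  have hF : Function.Injective F := by
    rw [← LinearMap.ker_eq_bot, LinearMap.ker_eq_bot']
    intro x hx
    have h1 : (x : P × Q).1 = 0 := by simpa [F] using congrArg Prod.fst hx
    have hp : p x = 0 := Subtype.ext h1
    have h2 : (x : P × Q).2 = 0 := by simpa [F, hp] using congrArg Prod.snd hx
    exact Subtype.ext (Prod.ext h1 h2)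
  obtain ⟨g, hg⟩ := h _ F hF
  refine ⟨LinearMap.snd S P Q ∘ₗ g ∘ₗ LinearMap.inl S P Q, fun n => ?_⟩
  have hn : ((n : P), (0 : Q)) ∈ N.prod (⊤ : Submodule S Q) := ⟨n.2, trivial⟩
  have hpn : p ⟨_, hn⟩ = n := rfl
  have := congrArg Prod.snd (hg ⟨_, hn⟩)
  simpa [F, hpn] using this

theorem Submodule.coprod_subtype_injective {A K : Submodule S M} (h : Disjoint A K) :
    Function.Injective (A.subtype.coprod K.subtype) := by
  rw [← LinearMap.ker_eq_bot, LinearMap.ker_coprod_of_disjoint_range _ _ (by simpa using h)]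
  simp

/-- Disjoint submodules are injective relative to each other. -/
theorem isRelativelyInjective_of_disjoint
    (hM : ∀ I : Submodule S M, IsAutomorphismInvariant S I) {A K : Submodule S M}
    (h : Disjoint A K) : IsRelativelyInjective S A K :=
  ((hM _).of_equiv (LinearEquiv.ofInjective _
    (Submodule.coprod_subtype_injective h)).symm).isRelativelyInjective_of_prod

theorem IsRelativelyInjective.of_isCompl {Q : Type*} [AddCommGroup Q] [Module S Q]
    {A K : Submodule S M} (h : IsCompl A K) (hA : IsRelativelyInjective S A Q)
    (hK : IsRelativelyInjective S K Q) : IsRelativelyInjective S M Q := by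
  intro N f
  let a : N.comap A.subtype →ₗ[S] N := A.subtype.restrict (fun x hx => hx)
  obtain ⟨g₁, hg₁⟩ := hA _ (f ∘ₗ a)
  let π₁ := A.projectionOnto K h
  let π₂ := K.projectionOnto A h.symm
  let f' : N →ₗ[S] Q := f - g₁ ∘ₗ π₁ ∘ₗ N.subtype
  let q : N →ₗ[S] K := π₂ ∘ₗ N.subtype
  have hker : LinearMap.ker q ≤ LinearMap.ker f' := by
    intro x hx
    have hxA : (x : M) ∈ A := by
      have : π₂ (x : M) = 0 := hx
      simpa [π₂] using this
    have h1 : π₁ (x : M) = ⟨x, hxA⟩ := A.projectionOnto_apply_left h ⟨x, hxA⟩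
    have h2 := hg₁ ⟨⟨x, hxA⟩, x.2⟩
    have h3 : a ⟨⟨x, hxA⟩, x.2⟩ = x := rfl
    simp only [LinearMap.comp_apply, h3] at h2
    simp [f', h1, h2]
  let k : LinearMap.range q →ₗ[S] Q :=
    (LinearMap.ker q).liftQ f' hker ∘ₗ q.quotKerEquivRange.symm.toLinearMap
  obtain ⟨g₂, hg₂⟩ := hK _ k
  refine ⟨g₁ ∘ₗ π₁ + g₂ ∘ₗ π₂, fun n => ?_⟩
  have h1 : g₂ (q n) = f' n := by
    rw [hg₂ ⟨q n, n, rfl⟩]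
    have : q.quotKerEquivRange.symm ⟨q n, n, rfl⟩ = Submodule.Quotient.mk n := by
      rw [LinearEquiv.symm_apply_eq]; rfl
    simp only [k, LinearMap.comp_apply, LinearEquiv.coe_coe, this, Submodule.liftQ_apply]
  have h2 : π₂ (n : M) = q n := rfl
  simp [h2, h1, f']

theorem IsRelativelyInjective.exists_retraction {P : Type*} [AddCommGroup P] [Module S P]
    {X : Submodule S P} (h : IsRelativelyInjective S P X) :
    ∃ ρ : P →ₗ[S] X, ∀ x : X, ρ x = x :=
  h X LinearMap.id

theorem Submodule.exists_maximal_disjoint {A B : Submodule S M} (h : Disjoint A B) :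
    ∃ K : Submodule S M, B ≤ K ∧ Maximal (Disjoint A) K := by
  obtain ⟨K, hBK, hK⟩ := zorn_le_nonempty₀ {K : Submodule S M | Disjoint A K}
    (fun c hc hchain _ _ => ⟨sSup c,
      hchain.directedOn.disjoint_sSup_right.2 fun b hb => hc hb, fun z hz => le_sSup hz⟩) B h
  exact ⟨K, hBK, hK⟩

/-- If `A` is closed relative to `K`, every map `K → A` extends to the whole module. -/
theorem exists_extension_of_maximal_disjoint
    (hM : ∀ I : Submodule S M, IsAutomorphismInvariant S I) {A K : Submodule S M}
    (hAK : Disjoint A K) (hmax : ∀ A', A ≤ A' → Disjoint A' K → A' ≤ A) (h : K →ₗ[S] A) :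
    ∃ g : M →ₗ[S] A, ∀ k : K, g k = h k := by
  let i : A × K →ₗ[S] M := A.subtype.coprod K.subtype
  have hi : Function.Injective i := Submodule.coprod_subtype_injective hAK
  have : Fact (Function.Injective i) := ⟨hi⟩
  let f : A × K →ₗ[S] A := h ∘ₗ LinearMap.snd S A K
  let T := Module.Baer.extensionOfMax i f
  have hTA : ∀ (x : T.domain) (_ : (x : M) ∈ A), T.toLinearPMap x = 0 := by
    intro x hx
    have := T.is_extension (⟨x, hx⟩, 0)
    simp only [f, i, LinearMap.comp_apply, LinearMap.snd_apply, map_zero] at this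
    rw [this]
    congr 1
    ext; simp
  let α : T.domain →ₗ[S] M := T.domain.subtype + A.subtype ∘ₗ T.toFun
  have hα : Function.Injective α := by
    rw [← LinearMap.ker_eq_bot, LinearMap.ker_eq_bot']
    intro x hx
    have hx' : (x : M) + (T.toLinearPMap x : A) = 0 := hx
    have hxA : (x : M) ∈ A := by
      rw [eq_neg_of_add_eq_zero_left hx']; exact A.neg_mem (Subtype.mem _)
    rw [hTA x hxA] at hx'
    exact Subtype.ext (by simpa using hx')
  obtain ⟨g, hg⟩ := ((hM ⊤).of_equiv Submodule.topEquiv) T.domain α hα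
  let d : M →ₗ[S] M := g - LinearMap.id
  have hd : ∀ x : T.domain, d x = (T.toLinearPMap x : A) := by
    intro x
    have : g x = (x : M) + (T.toLinearPMap x : A) := hg x
    simp [d, this]
  let D : Submodule S M := (LinearMap.range i).comap d
  let w : D →ₗ[S] A := LinearMap.fst S A K ∘ₗ (LinearEquiv.ofInjective i hi).symm.toLinearMap ∘ₗ
    d.restrict (fun x hx => hx)
  have hw : ∀ (x : D) (a : A) (k : K), d x = a + k → w x = a := by
    intro x a k hx
    have : (LinearEquiv.ofInjective i hi).symm ((d.restrict (fun x hx => hx) :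
        D →ₗ[S] LinearMap.range i) x) = (a, k) := by
      rw [LinearEquiv.symm_apply_eq]
      exact Subtype.ext hx
    simp only [w, LinearMap.comp_apply, LinearEquiv.coe_coe, this, LinearMap.fst_apply]
  have hTD : T.domain ≤ D := fun x hx => ⟨(T.toLinearPMap ⟨x, hx⟩, 0), by
    simp [i, hd ⟨x, hx⟩]⟩
  have hwT : ∀ (x : T.domain), w ⟨x, hTD x.2⟩ = T.toLinearPMap x := fun x =>
    hw _ _ 0 (by simp [hd x])
  let W : Module.Baer.ExtensionOf i f :=
    { domain := D
      toFun := w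
      le := T.le.trans hTD
      is_extension := fun m => (T.is_extension m).trans (hwT ⟨i m, T.le ⟨m, rfl⟩⟩).symm }
  have hTW : T ≤ W := ⟨hTD, fun x y hxy => by
    have : y = ⟨x, hTD x.2⟩ := Subtype.ext hxy.symm
    rw [this]
    exact (hwT x).symm⟩
  have hWT : W = T := Module.Baer.extensionOfMax_is_max i f W hTW
  have hDT : D ≤ T.domain := by
    have : W.domain ≤ T.domain := by rw [hWT]
    exact this
  have hdisj : Disjoint (A ⊔ LinearMap.range d) K := by
    rw [Submodule.disjoint_def]
    intro x hx hxK
    obtain ⟨a, ha, _, ⟨y, rfl⟩, rfl⟩ := Submodule.mem_sup.1 hx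
    have hyD : y ∈ D := ⟨(⟨-a, A.neg_mem ha⟩, ⟨_, hxK⟩), by simp [i]⟩
    have hyA : d y ∈ A := by
      rw [hd ⟨y, hDT hyD⟩]; exact Subtype.mem _
    exact Submodule.disjoint_def.1 hAK _ (A.add_mem ha hyA) hxK
  have hdA : ∀ x, d x ∈ A := fun x =>
    hmax _ le_sup_left hdisj (Submodule.mem_sup_right ⟨x, rfl⟩)
  refine ⟨d.codRestrict A hdA, fun k => Subtype.ext ?_⟩
  have hk : (k : M) ∈ T.domain := T.le ⟨(0, k), by simp [i]⟩
  have h1 := T.is_extension (0, k)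
  have h2 : (⟨i (0, k), T.le ⟨(0, k), rfl⟩⟩ : T.domain) = ⟨k, hk⟩ := Subtype.ext (by simp [i])
  rw [h2] at h1
  rw [LinearMap.codRestrict_apply, hd ⟨k, hk⟩, ← h1]
  rfl

/-- A submodule is injective relative to any module isomorphic to a submodule disjoint from it. -/
theorem isRelativelyInjective_of_disjoint_of_equiv
    (hM : ∀ I : Submodule S M, IsAutomorphismInvariant S I) {P X B : Submodule S M}
    (h : Disjoint X B) (e : P ≃ₗ[S] B) : IsRelativelyInjective S P X :=
  (isRelativelyInjective_of_disjoint hM h.symm).of_equiv e.symm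

/-- A submodule isomorphic to a submodule of `K` is closed relative to a maximal `K` disjoint
from it. -/
theorem le_of_maximal_disjoint_of_equiv
    (hM : ∀ I : Submodule S M, IsAutomorphismInvariant S I) {A B K : Submodule S M}
    (e : A ≃ₗ[S] B) (hBK : B ≤ K) (hK : Maximal (Disjoint A) K) {A' : Submodule S M}
    (hAA' : A ≤ A') (hA'K : Disjoint A' K) : A' ≤ A := by
  have hess : ∀ X ≤ A', Disjoint A X → X = ⊥ := by
    intro X hX hAX
    have h1 : Disjoint A (X ⊔ K) := by
      rw [Submodule.disjoint_def]
      intro a ha haX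
      obtain ⟨x, hx, k, hk, rfl⟩ := Submodule.mem_sup.1 haX
      have hk0 : k = 0 := Submodule.disjoint_def.1 hA'K k
        (by simpa using A'.sub_mem (hAA' ha) (hX hx)) hk
      subst hk0
      exact Submodule.disjoint_def.1 hAX _ ha (by simpa using hx)
    have h2 : X ≤ K := le_sup_left.trans (hK.2 h1 le_sup_right)
    exact disjoint_self.1 (hA'K.mono hX h2)
  have hinj : ∀ {Q : Type _} [AddCommGroup Q] [Module S Q] (u : A' →ₗ[S] Q),
      (∀ x : A', (x : M) ∈ A → u x = 0 → x = 0) → Function.Injective u := by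
    intro Q _ _ u hu
    rw [← LinearMap.ker_eq_bot]
    have := hess ((LinearMap.ker u).map A'.subtype) (Submodule.map_subtype_le _ _) (by
      rw [Submodule.disjoint_def]
      rintro _ ha ⟨x, hx, rfl⟩
      simpa using hu x ha hx)
    exact Submodule.map_injective_of_injective A'.injective_subtype
      (this.trans (Submodule.map_bot _).symm)
  obtain ⟨φ, hφ⟩ := isRelativelyInjective_of_disjoint hM hA'K (A.comap A'.subtype)
    (Submodule.inclusion hBK ∘ₗ e.toLinearMap ∘ₗ A'.subtype.restrict (fun x hx => hx))
  have hφinj : Function.Injective φ := hinj φ (fun x hx h0 => by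
    have h1 := (hφ ⟨x, hx⟩).symm.trans h0
    have h2 := congrArg (fun y : K => (y : M)) h1
    have h3 : e ⟨x, hx⟩ = 0 := Subtype.ext h2
    rw [LinearEquiv.map_eq_zero_iff] at h3
    exact Subtype.ext (congrArg (fun y : A => (y : M)) h3))
  have hφ' : Function.Injective (K.subtype ∘ₗ φ) := K.injective_subtype.comp hφinj
  have hdis : Disjoint A (LinearMap.range (K.subtype ∘ₗ φ)) :=
    hK.1.mono_right (by rintro _ ⟨x, rfl⟩; exact (φ x).2)
  obtain ⟨ρ, hρ⟩ := isRelativelyInjective_of_disjoint_of_equiv hM hdis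
    (LinearEquiv.ofInjective _ hφ') (A.comap A'.subtype) (A'.subtype.restrict (fun x hx => hx))
  have hρA : ∀ a : A, ρ ⟨a, hAA' a.2⟩ = a := fun a => hρ ⟨⟨a, hAA' a.2⟩, a.2⟩
  have hρinj : Function.Injective ρ := hinj ρ (fun x hx h0 => by
    have := (hρA ⟨x, hx⟩).symm.trans h0
    exact Subtype.ext (congrArg (fun y : A => (y : M)) this))
  intro x hx
  have := hρinj (hρA (ρ ⟨x, hx⟩))
  have hxρ : ((ρ ⟨x, hx⟩ : A) : M) = x := congrArg Subtype.val this
  exact hxρ ▸ (ρ ⟨x, hx⟩).2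

theorem exists_retraction_of_disjoint_of_equiv
    (hM : ∀ I : Submodule S M, IsAutomorphismInvariant S I) {A B : Submodule S M}
    (h : Disjoint A B) (e : A ≃ₗ[S] B) : ∃ ψ : M →ₗ[S] A, ∀ a : A, ψ a = a := by
  obtain ⟨L, hAL, hL⟩ := Submodule.exists_maximal_disjoint h.symm
  obtain ⟨φ, hφ⟩ := isRelativelyInjective_of_disjoint hM hL.1.symm (A.comap L.subtype)
    (e.toLinearMap ∘ₗ L.subtype.restrict (fun x hx => hx))
  obtain ⟨g, hg⟩ := exists_extension_of_maximal_disjoint hM hL.1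
    (fun A' h1 h2 => le_of_maximal_disjoint_of_equiv hM e.symm hAL hL h1 h2) φ
  refine ⟨e.symm.toLinearMap ∘ₗ g, fun a => ?_⟩
  have h1 : g a = e a := (hg ⟨a, hAL a.2⟩).trans (hφ ⟨⟨a, hAL a.2⟩, a.2⟩)
  simp [h1]

theorem isRelativelyInjective_self_of_disjoint_of_equiv
    (hM : ∀ I : Submodule S M, IsAutomorphismInvariant S I) {A B : Submodule S M}
    (h : Disjoint A B) (e : A ≃ₗ[S] B) : IsRelativelyInjective S M A := by
  obtain ⟨ψ, hψ⟩ := exists_retraction_of_disjoint_of_equiv hM h e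
  have hc := LinearMap.isCompl_of_proj hψ
  exact (isRelativelyInjective_of_disjoint_of_equiv hM h e).of_isCompl hc
    (isRelativelyInjective_of_disjoint hM hc.disjoint.symm)

theorem exists_retraction_onto_submodule
    (hM : ∀ I : Submodule S M, IsAutomorphismInvariant S I) {A B : Submodule S M}
    (h : Disjoint A B) (e : A ≃ₗ[S] B) (X : Submodule S M) (hX : X ≤ A) :
    ∃ ρ : A →ₗ[S] X, ∀ x : X, ρ ⟨x, hX x.2⟩ = x := by
  obtain ⟨ρ, hρ⟩ := isRelativelyInjective_of_disjoint_of_equiv hM (h.mono_left hX) e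
    (X.comap A.subtype) (A.subtype.restrict (fun x hx => hx))
  exact ⟨ρ, fun x => hρ ⟨⟨x, hX x.2⟩, x.2⟩⟩

theorem isSemisimpleModule_of_disjoint_of_equiv
    (hM : ∀ I : Submodule S M, IsAutomorphismInvariant S I) {A B : Submodule S M}
    (h : Disjoint A B) (e : A ≃ₗ[S] B) : IsSemisimpleModule S A := by
  rw [isSemisimpleModule_iff]
  refine ⟨fun X => ?_⟩
  let j := Submodule.equivMapOfInjective A.subtype A.injective_subtype X
  obtain ⟨ρ, hρ⟩ := exists_retraction_onto_submodule hM h e (X.map A.subtype)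
    (Submodule.map_subtype_le _ _)
  refine ⟨_, LinearMap.isCompl_of_proj (f := j.symm.toLinearMap ∘ₗ ρ) fun x => ?_⟩
  have : ρ (x : A) = j x := hρ (j x)
  simp [this]

end RelativeInjectivity

theorem IsRelativelyInjective.baer {R : Type*} [Ring R] {Q : Type*} [AddCommGroup Q]
    [Module Rᵐᵒᵖ Q] (h : IsRelativelyInjective Rᵐᵒᵖ R Q) : Module.Baer Rᵐᵒᵖ Q := by
  let e : R ≃ₗ[Rᵐᵒᵖ] Rᵐᵒᵖ := { MulOpposite.opAddEquiv with map_smul' := fun _ _ => rfl }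
  intro I f
  obtain ⟨g, hg⟩ := h.of_equiv e I f
  exact ⟨g, fun x hx => hg ⟨x, hx⟩⟩

/-- If `R` retracts onto the right ideal generated by `a`, then `a` is not a nonzero singular
element. -/
theorem eq_zero_of_isEssentialRightIdeal_rightAnnihilator {R : Type*} [Ring R] (a : R)
    (p : R →ₗ[Rᵐᵒᵖ] rightIdealOf R a) (hp : p a = a)
    (ha : IsEssentialRightIdeal R (rightAnnihilator R a)) : a = 0 := by
  obtain ⟨c, hc⟩ : ∃ c, (p 1 : R) = a * c := (p 1).2
  have hpa : p a = MulOpposite.op a • p 1 := by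
    rw [← map_smul]; simp
  have haca : a * c * a = a := by
    rw [hpa] at hp
    simpa [hc] using hp
  have hJ := ha (rightIdealOf R (c * a)) (by
    rw [eq_bot_iff]
    rintro _ ⟨hx, r, rfl⟩
    have h1 : a * (c * a * r) = 0 := hx
    have h2 : a * r = 0 := by rw [← haca, ← h1]; simp only [mul_assoc]
    simp [mul_assoc, h2])
  have hca : c * a ∈ rightIdealOf R (c * a) := ⟨1, by simp⟩
  rw [hJ, Submodule.mem_bot] at hca
  rw [← haca, mul_assoc, hca, mul_zero]

/-- if `A`, `B` are right ideals of a right `a`-ring with `A ∩ B = 0`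
and `A ≅ B`, then `A` is semisimple, injective, and nonsingular. -/
theorem rightARing_disjoint_iso_ideal (R : Type*) [Ring R] (hR : IsRightARing R)
    (A B : Submodule Rᵐᵒᵖ R) (hAB : A ⊓ B = ⊥)
    (hiso : Nonempty ((A : Type _) ≃ₗ[Rᵐᵒᵖ] B)) :
    IsSemisimpleModule Rᵐᵒᵖ A ∧ Module.Injective Rᵐᵒᵖ A ∧
      ∀ a : A, IsEssentialRightIdeal R (rightAnnihilator R (a : R)) → a = 0 := by
  obtain ⟨e⟩ := hiso
  have hd : Disjoint A B := disjoint_iff.2 hAB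
  refine ⟨isSemisimpleModule_of_disjoint_of_equiv hR hd e,
    (IsRelativelyInjective.baer
      (isRelativelyInjective_self_of_disjoint_of_equiv hR hd e)).injective, fun a ha => ?_⟩
  have hle : rightIdealOf R (a : R) ≤ A := by
    rintro _ ⟨r, rfl⟩
    simpa using A.smul_mem (MulOpposite.op r) a.2
  obtain ⟨ρ, hρ⟩ := exists_retraction_onto_submodule hR hd e _ hle
  obtain ⟨ψ, hψ⟩ := exists_retraction_of_disjoint_of_equiv hR hd e
  have hmem : (a : R) ∈ rightIdealOf R (a : R) := ⟨1, by simp⟩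
  refine Subtype.ext (eq_zero_of_isEssentialRightIdeal_rightAnnihilator (a : R) (ρ ∘ₗ ψ) ?_ ha)
  rw [LinearMap.comp_apply, hψ]
  exact congrArg Subtype.val (hρ ⟨a, hmem⟩)
end

section
/- Every right a-ring R decomposes as a ring direct product R = S × T, where S is a semisimple artinian ring that is square-full as a right S-module and T is a right square-free ring; equivalently, there is a central idempotent e of R such that eR is a square-full semisimple artinian ring and (1-e)R is a right square-free ring. -/
section AutomorphismInvariant

variable {A : Type*} [Ring A] {M : Type*} [AddCommGroup M] [Module A M]

/-- A map extension property: in an automorphism-invariant module, an injection factors through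
any other injection with the same domain. -/
theorem IsAutomorphismInvariant.exists_comp_eq {P : Type*} [AddCommGroup P] [Module A P]
    (hM : IsAutomorphismInvariant A M) (i j : P →ₗ[A] M) (hi : Function.Injective i)
    (hj : Function.Injective j) : ∃ g : M →ₗ[A] M, ∀ x, g (i x) = j x := by
  obtain ⟨g, hg⟩ := hM (LinearMap.range i) (j ∘ₗ (LinearEquiv.ofInjective i hi).symm)
    (hj.comp (LinearEquiv.ofInjective i hi).symm.injective)
  refine ⟨g, fun x ↦ ?_⟩
  have := hg (LinearEquiv.ofInjective i hi x)
  simpa using this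

theorem IsAutomorphismInvariant.congr {P : Type*} [AddCommGroup P] [Module A P]
    (e : P ≃ₗ[A] M) (hM : IsAutomorphismInvariant A M) : IsAutomorphismInvariant A P := by
  intro N f hf
  obtain ⟨g, hg⟩ := hM.exists_comp_eq (e.toLinearMap ∘ₗ N.subtype) (e.toLinearMap ∘ₗ f)
    (e.injective.comp N.subtype_injective) (e.injective.comp hf)
  refine ⟨e.symm.toLinearMap ∘ₗ g ∘ₗ e.toLinearMap, fun n ↦ ?_⟩
  have := hg n
  simp only [LinearMap.comp_apply, LinearEquiv.coe_coe, Submodule.subtype_apply] at this ⊢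
  rw [this, e.symm_apply_apply]

/-- `N` has an isomorphic copy which is disjoint from it. -/
def HasDisjointCopy (N : Submodule A M) : Prop :=
  ∃ f : N →ₗ[A] M, Function.Injective f ∧ Disjoint N (LinearMap.range f)

/-- `N` is the image of a projection. -/
def IsRetract (N : Submodule A M) : Prop :=
  ∃ p : M →ₗ[A] M, (∀ x, p x ∈ N) ∧ ∀ x ∈ N, p x = x

theorem Disjoint.eq_zero_of_mem_range {N : Submodule A M} {f : N →ₗ[A] M}
    (h : Disjoint N (LinearMap.range f)) (hf : Function.Injective f) {a : N}
    (ha : f a ∈ N) : a = 0 :=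
  (map_eq_zero_iff f hf).1 (Submodule.disjoint_def.1 h _ ha ⟨a, rfl⟩)

theorem IsAutomorphismInvariant.of_forall_submodule
    (hM : ∀ I : Submodule A M, IsAutomorphismInvariant A I) : IsAutomorphismInvariant A M :=
  (hM ⊤).congr Submodule.topEquiv.symm

theorem HasDisjointCopy.isSemisimpleModule
    (hM : ∀ I : Submodule A M, IsAutomorphismInvariant A I)
    {N : Submodule A M} (hN : HasDisjointCopy N) :
    IsSemisimpleModule A N := by
  obtain ⟨f, hf, hd⟩ := hN
  refine (isSemisimpleModule_iff A N).2 ⟨fun N' ↦ ?_⟩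
  let φ : N' × N →ₗ[A] M := (N.subtype ∘ₗ N'.subtype).coprod f
  have hφ : Function.Injective φ := by
    rw [injective_iff_map_eq_zero]
    rintro ⟨a, b⟩ h
    have h' : ((a : N) : M) + f b = 0 := h
    have hb : b = 0 := by
      refine hd.eq_zero_of_mem_range hf ?_
      rw [eq_neg_of_add_eq_zero_right h']
      exact N.neg_mem (a : N).2
    subst hb
    simpa using h'
  have hP : IsAutomorphismInvariant A (N' × N) := (hM _).congr (LinearEquiv.ofInjective φ hφ)
  let i : N' × N' →ₗ[A] N' × N := LinearMap.prodMap LinearMap.id N'.subtype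
  let j : N' × N' →ₗ[A] N' × N :=
    (LinearMap.fst A N' N' + LinearMap.snd A N' N').prod (N'.subtype ∘ₗ LinearMap.snd A N' N')
  have hi : Function.Injective i := by
    rintro ⟨a, b⟩ ⟨c, d⟩ h
    simpa [i] using h
  have hj : Function.Injective j := by
    rintro ⟨a, b⟩ ⟨c, d⟩ h
    have h₁ : a + b = c + d := congrArg Prod.fst h
    have h₂ : (b : N) = d := congrArg Prod.snd h
    have h₃ : b = d := Subtype.ext h₂
    subst h₃
    simpa using h₁
  obtain ⟨g, hg⟩ := hP.exists_comp_eq i j hi hj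
  refine ⟨_, LinearMap.isCompl_of_proj
    (f := LinearMap.fst A N' N ∘ₗ g ∘ₗ LinearMap.inr A N' N) fun x ↦ ?_⟩
  have := congrArg Prod.fst (hg (0, x))
  simpa [i, j] using this

theorem HasDisjointCopy.eq_of_essential
    (hM : ∀ I : Submodule A M, IsAutomorphismInvariant A I)
    {N C : Submodule A M} (hN : HasDisjointCopy N)
    (hNC : N ≤ C) (hess : ∀ D ≤ C, Disjoint D N → D = ⊥) : C = N := by
  obtain ⟨f, hf, hd⟩ := hN
  let i : N × N →ₗ[A] M := N.subtype.coprod f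
  let j : N × N →ₗ[A] M := f.coprod N.subtype
  have hi : Function.Injective i := by
    rw [injective_iff_map_eq_zero]
    rintro ⟨a, b⟩ h
    have h' : (a : M) + f b = 0 := h
    have hb : b = 0 := by
      refine hd.eq_zero_of_mem_range hf ?_
      rw [eq_neg_of_add_eq_zero_right h']
      exact N.neg_mem a.2
    subst hb
    simpa using h'
  have hj : Function.Injective j := by
    intro x y h
    refine Prod.swap_injective (hi ?_)
    simpa [i, j, add_comm] using h
  obtain ⟨g, hg⟩ := (IsAutomorphismInvariant.of_forall_submodule hM).exists_comp_eq i j hi hj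
  have hg₁ (a : N) : g a = f a := by simpa [i, j] using hg (a, 0)
  have hker : C ⊓ LinearMap.ker g = ⊥ := by
    refine hess _ inf_le_left (Submodule.disjoint_def.2 fun x hx hxN ↦ ?_)
    have h₀ : f ⟨x, hxN⟩ = 0 := by rw [← hg₁]; exact hx.2
    simpa using (map_eq_zero_iff f hf).1 h₀
  have hcom : C ⊓ N.comap g = ⊥ := by
    refine hess _ inf_le_left (Submodule.disjoint_def.2 fun x hx hxN ↦ ?_)
    have h₀ : f ⟨x, hxN⟩ ∈ N := by rw [← hg₁]; exact hx.2
    simpa using hd.eq_zero_of_mem_range hf h₀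
  have hdis : C ⊓ C.map g = ⊥ := by
    refine hess _ inf_le_left (Submodule.disjoint_def.2 fun x hx hxN ↦ ?_)
    obtain ⟨c, hc, rfl⟩ := hx.2
    have : c ∈ C ⊓ N.comap g := ⟨hc, hxN⟩
    rw [hcom, Submodule.mem_bot] at this
    rw [this, map_zero]
  have hC : HasDisjointCopy C := by
    refine ⟨g ∘ₗ C.subtype, ?_, ?_⟩
    · rw [injective_iff_map_eq_zero]
      intro c hc
      have : (c : M) ∈ C ⊓ LinearMap.ker g := ⟨c.2, hc⟩
      rw [hker] at this
      simpa using this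
    · rw [LinearMap.range_comp, Submodule.range_subtype, disjoint_iff, hdis]
  have := hC.isSemisimpleModule hM
  obtain ⟨Q, hQ⟩ := exists_isCompl (N.comap C.subtype)
  have hQ' : Q.map C.subtype = ⊥ := by
    refine hess _ (Submodule.map_subtype_le _ _) (Submodule.disjoint_def.2 ?_)
    rintro _ ⟨q, hq, rfl⟩ hqN
    simpa using Submodule.disjoint_def.1 hQ.disjoint q hqN hq
  replace hQ' : Q = ⊥ := Submodule.map_injective_of_injective C.subtype_injective (by simpa using hQ')
  have htop := hQ.sup_eq_top
  rw [hQ', sup_bot_eq, Submodule.comap_subtype_eq_top] at htop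
  exact le_antisymm htop hNC

theorem HasDisjointCopy.exists_linearMap
    (hM : ∀ I : Submodule A M, IsAutomorphismInvariant A I)
    {N : Submodule A M} {f : N →ₗ[A] M}
    (hf : Function.Injective f) (hd : Disjoint N (LinearMap.range f)) :
    ∃ r : M →ₗ[A] M, (∀ x, r x ∈ N) ∧ ∀ a, r (f a) = a := by
  obtain ⟨K, hNK, hK⟩ := zorn_le_nonempty₀ {K : Submodule A M | Disjoint K (LinearMap.range f)}
    (fun c hc hchain y hy ↦ ⟨sSup c, by
      rw [Set.mem_ofPred_eq, hchain.directedOn.disjoint_sSup_left]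
      exact fun K hK ↦ hc hK, fun z ↦ le_sSup⟩) N hd
  have hKd : Disjoint K (LinearMap.range f) := hK.prop
  have hfK {a : N} (h : f a ∈ K) : a = 0 :=
    (map_eq_zero_iff f hf).1 (Submodule.disjoint_def.1 hKd _ h ⟨a, rfl⟩)
  let i : N × K →ₗ[A] M := f.coprod K.subtype
  let j : N × K →ₗ[A] M := (f + N.subtype).coprod K.subtype
  have hi : Function.Injective i := by
    rw [injective_iff_map_eq_zero]
    rintro ⟨a, k⟩ h
    have h' : f a + (k : M) = 0 := h
    have ha : a = 0 := by
      refine hfK ?_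
      rw [eq_neg_of_add_eq_zero_left h']
      exact K.neg_mem k.2
    subst ha
    simpa using h'
  have hj : Function.Injective j := by
    rw [injective_iff_map_eq_zero]
    rintro ⟨a, k⟩ h
    have h' : f a + (a : M) + (k : M) = 0 := h
    have ha : a = 0 := by
      refine hfK ?_
      rw [add_assoc] at h'
      rw [eq_neg_of_add_eq_zero_left h']
      exact K.neg_mem (K.add_mem (hNK a.2) k.2)
    subst ha
    simpa using h'
  obtain ⟨g, hg⟩ := (IsAutomorphismInvariant.of_forall_submodule hM).exists_comp_eq i j hi hj
  let r : M →ₗ[A] M := g - LinearMap.id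
  have hra (a : N) : r (f a) = a := by
    have := hg (a, 0)
    simp only [i, j, LinearMap.coprod_apply, map_zero, add_zero, LinearMap.add_apply,
      Submodule.subtype_apply] at this
    simp [r, this]
  have hrk (k : M) (hk : k ∈ K) : r k = 0 := by
    have := hg (0, ⟨k, hk⟩)
    simp only [i, j, LinearMap.coprod_apply, map_zero, zero_add, Submodule.subtype_apply] at this
    simp [r, this]
  have hrange : LinearMap.range r = N := by
    refine HasDisjointCopy.eq_of_essential hM ⟨f, hf, hd⟩ (fun a ha ↦ ⟨f ⟨a, ha⟩, hra _⟩) ?_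
    intro D hD hDN
    have hKD : K ≤ D.comap r := fun k hk ↦ by simp [hrk k hk]
    have hle : D.comap r ≤ K := by
      refine hK.le_of_ge (y := D.comap r) ?_ hKD
      refine Submodule.disjoint_def.2 ?_
      rintro _ hx ⟨a, rfl⟩
      rw [Submodule.mem_comap, hra] at hx
      have := Submodule.disjoint_def.1 hDN _ hx a.2
      have ha : a = 0 := by simpa using this
      rw [ha, map_zero]
    rw [eq_bot_iff]
    intro d hd'
    obtain ⟨m, rfl⟩ := hD hd'
    exact (hrk m (hle hd'))
  exact ⟨r, fun x ↦ hrange ▸ ⟨x, rfl⟩, hra⟩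

theorem HasDisjointCopy.isRetract
    (hM : ∀ I : Submodule A M, IsAutomorphismInvariant A I)
    {N : Submodule A M} (hN : HasDisjointCopy N) :
    IsRetract N := by
  obtain ⟨f, hf, hd⟩ := hN
  let e := LinearEquiv.ofInjective f hf
  let f' : LinearMap.range f →ₗ[A] M := N.subtype ∘ₗ e.symm.toLinearMap
  have hr : LinearMap.range f' = N := by
    rw [LinearMap.range_comp_of_range_eq_top _ (LinearEquiv.range e.symm), Submodule.range_subtype]
  obtain ⟨r, hr₁, hr₂⟩ := HasDisjointCopy.exists_linearMap hM (f := f')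
    (N.subtype_injective.comp e.symm.injective) (hr.symm ▸ hd.symm)
  refine ⟨N.subtype ∘ₗ e.symm.toLinearMap ∘ₗ r.codRestrict _ hr₁, fun x ↦ Subtype.property _, ?_⟩
  intro x hx
  have h₁ : f' (e ⟨x, hx⟩) = x := by simp [f']
  have h₂ : r x = e ⟨x, hx⟩ := by rw [← hr₂, h₁]
  have h₃ : r.codRestrict _ hr₁ x = e ⟨x, hx⟩ := Subtype.ext h₂
  simp [h₃]

theorem IsRetract.bot : IsRetract (⊥ : Submodule A M) :=
  ⟨0, by simp, by simp⟩

theorem IsRetract.sup {X Z : Submodule A M} (hX : IsRetract X)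
    (h : ∀ π : M →ₗ[A] M, IsRetract (Z.map π)) : IsRetract (X ⊔ Z) := by
  obtain ⟨π, hπ, hπX⟩ := hX
  obtain ⟨ρ, hρ, hρZ⟩ := h (LinearMap.id - π)
  have hle : Z.map (LinearMap.id - π) ≤ X ⊔ Z := by
    rintro _ ⟨z, hz, rfl⟩
    exact sub_mem (Submodule.mem_sup_right hz) (Submodule.mem_sup_left (hπ z))
  refine ⟨π + ρ ∘ₗ (LinearMap.id - π),
    fun m ↦ add_mem (Submodule.mem_sup_left (hπ m)) (hle (hρ _)), fun x hx ↦ ?_⟩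
  obtain ⟨y, hy, z, hz, rfl⟩ := Submodule.mem_sup.1 hx
  have h₁ := hπX y hy
  have h₂ := hρZ _ (Submodule.mem_map_of_mem hz)
  simp only [LinearMap.sub_apply, LinearMap.id_apply] at h₂
  simp only [LinearMap.add_apply, LinearMap.comp_apply, LinearMap.sub_apply, LinearMap.id_apply,
    map_add, h₁, sub_self, map_zero, h₂]
  abel

/-- `Z` is simple and embeds in `N`. -/
def IsSimpleCopy (N Z : Submodule A M) : Prop :=
  IsSimpleModule A Z ∧ ∃ g : Z →ₗ[A] N, Function.Injective g

theorem IsSimpleCopy.congr {N Z Z' : Submodule A M} (h : IsSimpleCopy N Z) (e : Z' ≃ₗ[A] Z) :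
    IsSimpleCopy N Z' := by
  obtain ⟨hs, g, hg⟩ := h
  exact ⟨IsSimpleModule.congr e, g ∘ₗ e.toLinearMap, hg.comp e.injective⟩

theorem IsSimpleCopy.map {N Z : Submodule A M} (h : IsSimpleCopy N Z) (φ : M →ₗ[A] M) :
    Z.map φ = ⊥ ∨ IsSimpleCopy N (Z.map φ) := by
  have := h.1
  rcases LinearMap.injective_or_eq_zero (φ ∘ₗ Z.subtype) with hi | h₀
  · right
    have e := LinearEquiv.ofInjective _ hi
    rw [LinearMap.range_comp, Submodule.range_subtype] at e
    exact h.congr e.symm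
  · left
    rw [← LinearMap.range_eq_bot, LinearMap.range_comp, Submodule.range_subtype] at h₀
    exact h₀

theorem IsSimpleCopy.hasDisjointCopy {N Z : Submodule A M} (h : IsSimpleCopy N Z)
    (hN : HasDisjointCopy N) : HasDisjointCopy Z := by
  obtain ⟨hs, g, hg⟩ := h
  obtain ⟨f, hf, hd⟩ := hN
  by_cases hZN : Z ≤ N
  · exact ⟨f ∘ₗ g, hf.comp hg, hd.mono hZN (LinearMap.range_comp_le_range g f)⟩
  · refine ⟨N.subtype ∘ₗ g, N.subtype_injective.comp hg, ?_⟩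
    refine Disjoint.mono_right ((LinearMap.range_comp_le_range g _).trans N.range_subtype.le) ?_
    exact (IsSimpleModule.isAtom (m := Z)).not_le_iff_disjoint.1 hZN

theorem IsSimpleCopy.isRetract_finset_sup
    (hM : ∀ I : Submodule A M, IsAutomorphismInvariant A I)
    {N : Submodule A M} (hN : HasDisjointCopy N)
    (t : Finset (Submodule A M)) (ht : ∀ Z ∈ t, IsSimpleCopy N Z) : IsRetract (t.sup id) := by
  classical
  induction t using Finset.induction_on with
  | empty => exact IsRetract.bot
  | insert Z t _ ih =>
    rw [Finset.sup_insert, sup_comm]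
    refine (ih fun Y hY ↦ ht Y (Finset.mem_insert_of_mem hY)).sup fun π ↦ ?_
    rcases (ht Z (Finset.mem_insert_self _ _)).map π with h | h
    · rw [id, h]
      exact IsRetract.bot
    · exact (h.hasDisjointCopy hN).isRetract hM

/-- The sum of all simple submodules which embed in `N`. -/
def copySum (N : Submodule A M) : Submodule A M :=
  sSup {Z | IsSimpleCopy N Z}

theorem map_copySum_le (N : Submodule A M) (φ : M →ₗ[A] M) :
    (copySum N).map φ ≤ copySum N := by
  rw [Submodule.map_le_iff_le_comap]
  refine sSup_le fun Z hZ ↦ ?_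
  rw [← Submodule.map_le_iff_le_comap]
  rcases hZ.map φ with h | h
  · rw [h]
    exact bot_le
  · exact le_sSup h

theorem isSemisimpleModule_copySum (N : Submodule A M) : IsSemisimpleModule A (copySum N) := by
  rw [copySum, sSup_eq_iSup]
  refine isSemisimpleModule_biSup_of_isSemisimpleModule_submodule fun Z hZ ↦ ?_
  have := hZ.1
  infer_instance

theorem Submodule.sSup_isSimpleModule_le (L : Submodule A M) [IsSemisimpleModule A L] :
    sSup {Z : Submodule A M | IsSimpleModule A Z ∧ Z ≤ L} = L := by
  refine le_antisymm (sSup_le fun Z hZ ↦ hZ.2) ?_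
  have h := congrArg (Submodule.map L.subtype) (IsSemisimpleModule.sSup_simples_eq_top A L)
  rw [Submodule.map_subtype_top] at h
  refine h.ge.trans ?_
  rw [Submodule.map_le_iff_le_comap]
  refine sSup_le fun Z hZ ↦ ?_
  rw [← Submodule.map_le_iff_le_comap]
  have : IsSimpleModule A Z := hZ
  exact le_sSup ⟨IsSimpleModule.congr (Z.equivMapOfInjective _ L.subtype_injective).symm,
    Submodule.map_subtype_le _ _⟩

theorem le_copySum {N L : Submodule A M} [IsSemisimpleModule A L] (g : L →ₗ[A] N)
    (hg : Function.Injective g) : L ≤ copySum N := by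
  rw [← Submodule.sSup_isSimpleModule_le L]
  exact sSup_le fun Z hZ ↦ le_sSup
    ⟨hZ.1, g ∘ₗ Submodule.inclusion hZ.2, hg.comp (Submodule.inclusion_injective hZ.2)⟩

theorem isSimpleCopy_of_le_copySum {N Z : Submodule A M} [IsSimpleModule A Z]
    (h : Z ≤ copySum N) : IsSimpleCopy N Z := by
  have (m : {Z | IsSimpleCopy N Z}) : IsSimpleModule A m.1 := m.2.1
  obtain ⟨Y, hY, ⟨e⟩⟩ := Submodule.linearEquiv_of_le_sSup Z {Z | IsSimpleCopy N Z} h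
  exact IsSimpleCopy.congr hY e

theorem Submodule.FG.exists_finset_sup_eq {N : Submodule A M} (hN : N.FG)
    {s : Set (Submodule A M)} (hs : sSup s = N) :
    ∃ t : Finset (Submodule A M), ↑t ⊆ s ∧ t.sup id = N := by
  obtain ⟨t, hts, ht⟩ := (CompleteLattice.isCompactElement_iff_exists_le_sSup_of_le_sSup _ N).1
    ((Submodule.fg_iff_compact N).1 hN) s hs.ge
  exact ⟨t, hts, le_antisymm (Finset.sup_le fun Z hZ ↦ hs ▸ le_sSup (hts hZ)) ht⟩

theorem finite_isSimpleCopy {N J : Submodule A M} [IsSemisimpleModule A N] (hN : N.FG)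
    (hJ : ∀ X Y : Submodule A M, X ≤ J → Y ≤ J → Disjoint X Y → Nonempty (X ≃ₗ[A] Y) → X = ⊥) :
    {Z : Submodule A M | IsSimpleCopy N Z ∧ Z ≤ J}.Finite := by
  obtain ⟨t, hts, ht⟩ := hN.exists_finset_sup_eq (Submodule.sSup_isSimpleModule_le N)
  have key : ∀ Z ∈ {Z : Submodule A M | IsSimpleCopy N Z ∧ Z ≤ J},
      ∃ S ∈ t, Nonempty (Z ≃ₗ[A] S) := by
    rintro Z ⟨⟨hs, g, hg⟩, -⟩
    have e := LinearEquiv.ofInjective (N.subtype ∘ₗ g) (N.subtype_injective.comp hg)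
    have := IsSimpleModule.congr e.symm
    have (m : (t : Set (Submodule A M))) : IsSimpleModule A m.1 := (hts m.2).1
    obtain ⟨S, hS, ⟨e'⟩⟩ := Submodule.linearEquiv_of_le_sSup (LinearMap.range (N.subtype ∘ₗ g))
      (t : Set (Submodule A M)) (by
        rw [← Finset.sup_id_eq_sSup, ht]
        exact (LinearMap.range_comp_le_range g _).trans N.range_subtype.le)
    exact ⟨S, hS, ⟨e.trans e'⟩⟩
  choose! F hFt hF using key
  refine Set.Finite.of_injOn (t := (t : Set (Submodule A M))) (f := F) (fun Z hZ ↦ hFt Z hZ) ?_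
    t.finite_toSet
  intro Z hZ Z' hZ' hZZ'
  obtain ⟨e⟩ := hF Z hZ
  obtain ⟨e'⟩ := hF Z' hZ'
  rw [← hZZ'] at e'
  have := hZ.1.1
  have := hZ'.1.1
  have hZa := IsSimpleModule.isAtom (m := Z)
  have hZa' := IsSimpleModule.isAtom (m := Z')
  by_contra hne
  exact hZa.1 (hJ Z Z' hZ.2 hZ'.2 (hZa.disjoint_of_ne hZa' hne) ⟨e.trans e'.symm⟩)

/-- There is a submodule with a disjoint copy such that no further pair of isomorphic disjoint
submodules can be added. -/
theorem exists_maximal_disjointCopy (A M : Type*) [Ring A] [AddCommGroup M] [Module A M] :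
    ∃ (N : Submodule A M) (f : N →ₗ[A] M), Function.Injective f ∧
      Disjoint N (LinearMap.range f) ∧ ∀ X Y : Submodule A M, Disjoint X Y →
        Nonempty (X ≃ₗ[A] Y) → Disjoint (X ⊔ Y) (N ⊔ LinearMap.range f) → X = ⊥ := by
  obtain ⟨Γ, -, hΓ⟩ := zorn_le_nonempty₀
    {Γ : Submodule A (M × M) | ∀ p ∈ Γ, ∀ q ∈ Γ, p.1 + q.2 = 0 → p = 0 ∧ q = 0}
    (fun c hc hchain Γ₀ hΓ₀ ↦ ⟨sSup c, by
      intro p hp q hq h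
      rw [Submodule.mem_sSup_of_directed ⟨Γ₀, hΓ₀⟩ hchain.directedOn] at hp hq
      obtain ⟨Γ₁, h₁, hp⟩ := hp
      obtain ⟨Γ₂, h₂, hq⟩ := hq
      obtain ⟨Γ₃, h₃, h₁₃, h₂₃⟩ := hchain.directedOn Γ₁ h₁ Γ₂ h₂
      exact hc h₃ p (h₁₃ hp) q (h₂₃ hq) h, fun z ↦ le_sSup⟩) ⊥ (by
      rintro p rfl q rfl -
      exact ⟨rfl, rfl⟩)
  have hprop : ∀ p ∈ Γ, ∀ q ∈ Γ, p.1 + q.2 = 0 → p = 0 ∧ q = 0 := hΓ.prop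
  let φ : Γ →ₗ[A] M := LinearMap.fst A M M ∘ₗ Γ.subtype
  let ψ : Γ →ₗ[A] M := LinearMap.snd A M M ∘ₗ Γ.subtype
  have hφ : Function.Injective φ := by
    rw [injective_iff_map_eq_zero]
    intro p hp
    exact Subtype.ext (hprop p p.2 0 Γ.zero_mem (by simpa [φ] using hp)).1
  have hψ : Function.Injective ψ := by
    rw [injective_iff_map_eq_zero]
    intro p hp
    exact Subtype.ext (hprop 0 Γ.zero_mem p p.2 (by simpa [ψ] using hp)).2
  let e := LinearEquiv.ofInjective φ hφ
  have hr : LinearMap.range (ψ ∘ₗ e.symm.toLinearMap) = LinearMap.range ψ :=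
    LinearMap.range_comp_of_range_eq_top _ (LinearEquiv.range e.symm)
  refine ⟨LinearMap.range φ, ψ ∘ₗ e.symm.toLinearMap, hψ.comp e.symm.injective, ?_, ?_⟩
  · rw [hr, Submodule.disjoint_def]
    rintro _ ⟨p, rfl⟩ ⟨q, hq⟩
    have hq' : q.1.2 = p.1.1 := hq
    have := (hprop p p.2 (-q) (Γ.neg_mem q.2) (by simp [hq'])).1
    simp [φ, this]
  · rintro X Y hXY ⟨u⟩ hd
    rw [hr, Submodule.disjoint_def] at hd
    let Δ : Submodule A (M × M) := LinearMap.range (X.subtype.prod (Y.subtype ∘ₗ u.toLinearMap))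
    have hΔ : Δ ≤ Γ := by
      refine le_sup_right.trans (hΓ.le_of_ge (y := Γ ⊔ Δ) ?_ le_sup_left)
      intro p hp q hq h
      obtain ⟨p, hpΓ, _, ⟨x, rfl⟩, rfl⟩ := Submodule.mem_sup.1 hp
      obtain ⟨q, hqΓ, _, ⟨y, rfl⟩, rfl⟩ := Submodule.mem_sup.1 hq
      have h' : p.1 + x + (q.2 + u y) = 0 := h
      have hxy : (x : M) + u y = -(p.1 + q.2) := by
        rw [eq_neg_iff_add_eq_zero, ← h']
        abel
      have hxy₀ : (x : M) + u y = 0 := by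
        refine hd _ (Submodule.add_mem_sup x.2 (u y).2) ?_
        rw [hxy]
        exact neg_mem (Submodule.add_mem_sup ⟨⟨p, hpΓ⟩, rfl⟩ ⟨⟨q, hqΓ⟩, rfl⟩)
      have hx : (x : M) = 0 := by
        refine Submodule.disjoint_def.1 hXY _ x.2 ?_
        rw [eq_neg_of_add_eq_zero_left hxy₀]
        exact neg_mem (u y).2
      rw [hxy₀, eq_comm, neg_eq_zero] at hxy
      obtain ⟨rfl, rfl⟩ := hprop p hpΓ q hqΓ hxy
      have hx' : x = 0 := Subtype.ext hx
      have hy : y = 0 := by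
        rw [hx, zero_add] at hxy₀
        exact u.map_eq_zero_iff.1 (Subtype.ext hxy₀)
      simp [hx', hy]
    rw [Submodule.eq_bot_iff]
    intro x hx
    have hmem : (x, (u ⟨x, hx⟩ : M)) ∈ Γ := hΔ ⟨⟨x, hx⟩, rfl⟩
    refine hd x (Submodule.mem_sup_left hx) (Submodule.mem_sup_left ⟨⟨_, hmem⟩, rfl⟩)

theorem copySum_fg {N : Submodule A M} [IsSemisimpleModule A N] (hN : N.FG) {f : N →ₗ[A] M}
    (hf : Function.Injective f)
    (hmax : ∀ X Y : Submodule A M, Disjoint X Y →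
        Nonempty (X ≃ₗ[A] Y) → Disjoint (X ⊔ Y) (N ⊔ LinearMap.range f) → X = ⊥) :
    (copySum N).FG := by
  have := isSemisimpleModule_copySum N
  have := IsSemisimpleModule.range f
  have hle : N ⊔ LinearMap.range f ≤ copySum N :=
    sup_le (le_copySum LinearMap.id Function.injective_id)
      (le_copySum (LinearEquiv.ofInjective f hf).symm.toLinearMap (LinearEquiv.injective _))
  obtain ⟨Q, hQ⟩ := exists_isCompl ((N ⊔ LinearMap.range f).comap (copySum N).subtype)
  let J := Q.map (copySum N).subtype
  have hJS : J ≤ copySum N := Submodule.map_subtype_le _ _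
  have hJd : Disjoint J (N ⊔ LinearMap.range f) := by
    rw [Submodule.disjoint_def]
    rintro _ ⟨q, hq, rfl⟩ hqN
    simpa using Submodule.disjoint_def.1 hQ.disjoint q hqN hq
  have hsup : N ⊔ LinearMap.range f ⊔ J = copySum N := by
    have := congrArg (Submodule.map (copySum N).subtype) hQ.sup_eq_top
    rwa [Submodule.map_sup, Submodule.map_comap_subtype, inf_eq_right.2 hle,
      Submodule.map_subtype_top] at this
  have : IsSemisimpleModule A J :=
    .of_injective (Submodule.inclusion hJS) (Submodule.inclusion_injective hJS)
  have hfin := finite_isSimpleCopy (J := J) hN fun X Y hX hY hXY e ↦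
    hmax X Y hXY e (hJd.mono_left (sup_le hX hY))
  have hJ : J.FG := by
    rw [← Submodule.sSup_isSimpleModule_le J, sSup_eq_iSup']
    have : Finite {m : Submodule A M | IsSimpleModule A m ∧ m ≤ J} :=
      hfin.subset fun Z hZ ↦ ⟨have := hZ.1; isSimpleCopy_of_le_copySum (hZ.2.trans hJS), hZ.2⟩
    refine Submodule.fg_iSup _ fun Z ↦ ?_
    have := Z.2.1
    exact Module.Finite.iff_fg.1 inferInstance
  rw [← hsup]
  have : Module.Finite A N := Module.Finite.iff_fg.2 hN
  exact (hN.sup (Module.Finite.iff_fg.1 inferInstance)).sup hJ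

/-- A module all of whose submodules are automorphism-invariant, and whose retracts are finitely
generated, has a finitely generated fully invariant semisimple retract that is square-full and
whose complements are square-free. -/
theorem exists_fullyInvariant_retract
    (hM : ∀ I : Submodule A M, IsAutomorphismInvariant A I)
    (hfg : ∀ N : Submodule A M, IsRetract N → N.FG) :
    ∃ S : Submodule A M, IsRetract S ∧ IsSemisimpleModule A S ∧ (∀ φ : M →ₗ[A] M, S.map φ ≤ S) ∧
      (∀ U ≤ S, U ≠ ⊥ → ∃ N N₁ N₂ : Submodule A M, N ≠ ⊥ ∧ N ≤ U ∧ N₁ ≤ S ∧ N₂ ≤ S ∧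
        Disjoint N₁ N₂ ∧ Nonempty (N ≃ₗ[A] N₁) ∧ Nonempty (N ≃ₗ[A] N₂)) ∧
      ∀ X Y : Submodule A M, Disjoint X Y → Nonempty (X ≃ₗ[A] Y) → Disjoint (X ⊔ Y) S →
        X = ⊥ := by
  obtain ⟨N, f, hf, hd, hmax⟩ := exists_maximal_disjointCopy A M
  have hN : HasDisjointCopy N := ⟨f, hf, hd⟩
  have := hN.isSemisimpleModule hM
  have := isSemisimpleModule_copySum N
  have := IsSemisimpleModule.range f
  have hNS : N ≤ copySum N := le_copySum LinearMap.id Function.injective_id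
  have hfS : LinearMap.range f ≤ copySum N :=
    le_copySum (LinearEquiv.ofInjective f hf).symm.toLinearMap (LinearEquiv.injective _)
  have hSfg : (copySum N).FG := copySum_fg (hfg N (hN.isRetract hM)) hf hmax
  refine ⟨copySum N, ?_, isSemisimpleModule_copySum N, map_copySum_le N, ?_, ?_⟩
  · obtain ⟨t, hts, ht⟩ := hSfg.exists_finset_sup_eq rfl
    rw [← ht]
    exact IsSimpleCopy.isRetract_finset_sup hM hN t hts
  · intro U hU hne
    have : IsSemisimpleModule A U :=
      .of_injective (Submodule.inclusion hU) (Submodule.inclusion_injective hU)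
    obtain ⟨Z, hZU, hZ⟩ := (IsSemisimpleModule.eq_bot_or_exists_simple_le U).resolve_left hne
    obtain ⟨-, g, hg⟩ := isSimpleCopy_of_le_copySum (hZU.trans hU)
    have h₁ : LinearMap.range (N.subtype ∘ₗ g) ≤ N :=
      (LinearMap.range_comp_le_range g _).trans N.range_subtype.le
    have h₂ : LinearMap.range (f ∘ₗ g) ≤ LinearMap.range f := LinearMap.range_comp_le_range g f
    exact ⟨Z, _, _, IsSimpleModule.isAtom.1, hZU, h₁.trans hNS, h₂.trans hfS, hd.mono h₁ h₂,
      ⟨LinearEquiv.ofInjective _ (N.subtype_injective.comp hg)⟩,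
      ⟨LinearEquiv.ofInjective _ (hf.comp hg)⟩⟩
  · exact fun X Y hXY e hdS ↦ hmax X Y hXY e (hdS.mono_right (sup_le hNS hfS))

theorem IsSquareFullModule.of_forall_le {S : Submodule A M}
    (h : ∀ U ≤ S, U ≠ ⊥ → ∃ N N₁ N₂ : Submodule A M, N ≠ ⊥ ∧ N ≤ U ∧ N₁ ≤ S ∧ N₂ ≤ S ∧
      Disjoint N₁ N₂ ∧ Nonempty (N ≃ₗ[A] N₁) ∧ Nonempty (N ≃ₗ[A] N₂)) :
    IsSquareFullModule A S := by
  intro U hU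
  have hinj := Submodule.map_injective_of_injective S.subtype_injective
  obtain ⟨N, N₁, N₂, hN, hNU, h₁, h₂, hd, ⟨e₁⟩, ⟨e₂⟩⟩ := h (U.map S.subtype)
    (Submodule.map_subtype_le _ _) fun h₀ ↦ hU (hinj (by simpa using h₀))
  have hNS : N ≤ S := hNU.trans (Submodule.map_subtype_le _ _)
  refine ⟨N.comap S.subtype, N₁.comap S.subtype, N₂.comap S.subtype, fun h₀ ↦ hN ?_, ?_, ?_,
    ⟨?_⟩, ⟨?_⟩⟩
  · have := congrArg (Submodule.map S.subtype) h₀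
    rwa [Submodule.map_comap_subtype, inf_eq_right.2 hNS, Submodule.map_bot] at this
  · intro x hx
    obtain ⟨y, hy, hyx⟩ := hNU hx
    rwa [← S.subtype_injective hyx]
  · rw [← Submodule.comap_inf, hd.eq_bot, Submodule.comap_bot, Submodule.ker_subtype]
  · exact (Submodule.comapSubtypeEquivOfLe hNS).trans
      (e₁.trans (Submodule.comapSubtypeEquivOfLe h₁).symm)
  · exact (Submodule.comapSubtypeEquivOfLe hNS).trans
      (e₂.trans (Submodule.comapSubtypeEquivOfLe h₂).symm)

theorem IsSquareFreeModule.of_disjoint {S J : Submodule A M} (hJ : Disjoint J S)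
    (h : ∀ X Y : Submodule A M, Disjoint X Y → Nonempty (X ≃ₗ[A] Y) → Disjoint (X ⊔ Y) S →
      X = ⊥) : IsSquareFreeModule A J := by
  rintro X Y hXY ⟨e⟩
  have hinj := Submodule.map_injective_of_injective J.subtype_injective
  refine hinj ((h (X.map J.subtype) (Y.map J.subtype) ?_ ⟨?_⟩ ?_).trans (Submodule.map_bot _).symm)
  · rw [disjoint_iff, ← Submodule.map_inf _ J.subtype_injective, hXY, Submodule.map_bot]
  · exact (X.equivMapOfInjective _ J.subtype_injective).symm.trans
      (e.trans (Y.equivMapOfInjective _ J.subtype_injective))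
  · exact hJ.mono_left (sup_le (Submodule.map_subtype_le _ _) (Submodule.map_subtype_le _ _))

section RightIdeal

variable {R : Type*} [Ring R]

theorem LinearMap.eq_mul_of_mulOpposite (p : R →ₗ[Rᵐᵒᵖ] R) (x : R) : p x = p 1 * x := by
  have := p.map_smul (MulOpposite.op x) 1
  simpa using this

theorem IsRetract.exists_rightIdealOf_eq {N : Submodule Rᵐᵒᵖ R} (hN : IsRetract N) :
    ∃ e : R, IsIdempotentElem e ∧ rightIdealOf R e = N := by
  obtain ⟨p, hp, hpN⟩ := hN
  have hmul (x : R) : p 1 * x = p x := (p.eq_mul_of_mulOpposite x).symm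
  refine ⟨p 1, (hmul _).trans (hpN _ (hp 1)), le_antisymm ?_ fun x hx ↦ ⟨x, ?_⟩⟩
  · rintro _ ⟨r, rfl⟩
    rw [hmul]
    exact hp r
  · rw [hmul, hpN x hx]

theorem IsIdempotentElem.mem_rightIdealOf {e x : R} (he : IsIdempotentElem e) :
    x ∈ rightIdealOf R e ↔ e * x = x :=
  ⟨by rintro ⟨r, rfl⟩; rw [← mul_assoc, he.eq], fun h ↦ ⟨x, h.symm⟩⟩

theorem fg_rightIdealOf (e : R) : (rightIdealOf R e).FG := by
  refine ⟨{e}, le_antisymm (Submodule.span_le.2 ?_) ?_⟩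
  · simpa using ⟨1, (mul_one e).symm⟩
  · rintro _ ⟨r, rfl⟩
    exact Submodule.smul_mem _ (MulOpposite.op r) (Submodule.subset_span (by simp))

/-- An idempotent which generates a semisimple two-sided ideal as a right ideal is central. -/
theorem IsIdempotentElem.mem_center_of_isSemisimpleModule {e : R} (he : IsIdempotentElem e)
    [IsSemisimpleModule Rᵐᵒᵖ (rightIdealOf R e)] (hre : ∀ r : R, e * (r * e) = r * e) :
    e ∈ Set.center R := by
  have hzero (r : R) : e * r * (1 - e) = 0 := by
    set x := e * r * (1 - e) with hx
    have hxe : x * (1 - e) = x := by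
      rw [hx, mul_assoc, he.one_sub.eq]
    have hle : rightIdealOf R x ≤ rightIdealOf R e := by
      rintro _ ⟨s, rfl⟩
      exact ⟨r * (1 - e) * s, by simp only [hx, mul_assoc]⟩
    obtain ⟨g, hg⟩ := IsSemisimpleModule.extension_property (Submodule.inclusion hle)
      (Submodule.inclusion_injective hle) LinearMap.id
    let t : R := g ⟨e, ⟨1, (mul_one e).symm⟩⟩
    have hgt (y : R) (hy : y ∈ rightIdealOf R x) : t * y = y := by
      have h₁ : (g ⟨y, hle hy⟩ : R) = y :=
        congrArg Subtype.val (LinearMap.congr_fun hg ⟨y, hy⟩)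
      have h₂ : (⟨y, hle hy⟩ : rightIdealOf R e) =
          MulOpposite.op y • ⟨e, ⟨1, (mul_one e).symm⟩⟩ :=
        Subtype.ext (he.mem_rightIdealOf.1 (hle hy)).symm
      rw [h₂, map_smul] at h₁
      exact h₁
    obtain ⟨y, hy⟩ : t ∈ rightIdealOf R x := Subtype.property _
    have het : e * t = t := he.mem_rightIdealOf.1 (hle ⟨y, hy⟩)
    have ht : t = 0 := by
      rw [← hgt t ⟨y, hy⟩]
      calc t * t = x * (1 - e) * y * (e * t) := by rw [het, hxe, ← hy]
        _ = x * ((y * e - e * (y * e)) * t) := by noncomm_ring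
        _ = 0 := by rw [hre, sub_self, zero_mul, mul_zero]
    rw [← hgt x ⟨1, (mul_one x).symm⟩, ht, zero_mul]
  rw [Semigroup.mem_center_iff]
  intro r
  have h := hzero r
  rw [mul_sub, mul_one, sub_eq_zero] at h
  rw [h, mul_assoc, hre]

end RightIdeal

end AutomorphismInvariant

/-- a right `a`-ring decomposes, via a central idempotent `e`, as the
direct sum of the square-full semisimple artinian ring `eR` and the right
square-free ring `(1-e)R`. -/
theorem rightARing_decomposition (R : Type*) [Ring R] (hR : IsRightARing R) :
    ∃ e : R, IsIdempotentElem e ∧ e ∈ Set.center R ∧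
      IsSemisimpleModule Rᵐᵒᵖ (rightIdealOf R e) ∧
      IsArtinian Rᵐᵒᵖ (rightIdealOf R e) ∧
      IsSquareFullModule Rᵐᵒᵖ (rightIdealOf R e) ∧
      IsSquareFreeModule Rᵐᵒᵖ (rightIdealOf R (1 - e)) := by
  obtain ⟨S, hS, hss, hinv, hfull, hfree⟩ := exists_fullyInvariant_retract hR fun N hN ↦ by
    obtain ⟨e, -, rfl⟩ := hN.exists_rightIdealOf_eq
    exact fg_rightIdealOf e
  obtain ⟨e, he, rfl⟩ := hS.exists_rightIdealOf_eq
  have hre (r : R) : e * (r * e) = r * e :=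
    he.mem_rightIdealOf.1 (hinv (LinearMap.mulLeft Rᵐᵒᵖ r) ⟨e, ⟨1, (mul_one e).symm⟩, rfl⟩)
  have : Module.Finite Rᵐᵒᵖ (rightIdealOf R e) := Module.Finite.iff_fg.2 (fg_rightIdealOf e)
  refine ⟨e, he, he.mem_center_of_isSemisimpleModule hre, hss, inferInstance,
    .of_forall_le hfull, .of_disjoint (Submodule.disjoint_def.2 fun x hx₁ hx₂ ↦ ?_) hfree⟩
  rw [he.one_sub.mem_rightIdealOf, sub_mul, one_mul, he.mem_rightIdealOf.1 hx₂, sub_self] at hx₁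
  exact hx₁.symm
end

section
/- Let R be an indecomposable ring (the only central idempotents of R are 0 and 1) that contains a square, i.e., there exist nonzero right ideals A and B of R with A ∩ B = 0 and A ≅ B as right R-modules. Then R is a right a-ring if and only if R is a simple artinian ring. -/
namespace IsAutomorphismInvariant

variable {A M P Q : Type*} [Ring A] [AddCommGroup M] [Module A M] [AddCommGroup P] [Module A P]
  [AddCommGroup Q] [Module A Q]

/-- In an automorphism-invariant module, a monomorphism extends along any monomorphism. -/
theorem exists_extension (hM : IsAutomorphismInvariant A M) (i f : P →ₗ[A] M)
    (hi : Function.Injective i) (hf : Function.Injective f) :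
    ∃ g : M →ₗ[A] M, ∀ p, g (i p) = f p := by
  let e := LinearEquiv.ofInjective i hi
  obtain ⟨g, hg⟩ := hM (LinearMap.range i) (f ∘ₗ e.symm.toLinearMap)
    (hf.comp e.symm.injective)
  refine ⟨g, fun p ↦ ?_⟩
  have h := hg (e p)
  simpa [e] using h

theorem of_linearEquiv_s5 (hM : IsAutomorphismInvariant A M) (e : P ≃ₗ[A] M) :
    IsAutomorphismInvariant A P := by
  intro N f hf
  obtain ⟨g, hg⟩ := hM.exists_extension (e.toLinearMap ∘ₗ N.subtype) (e.toLinearMap ∘ₗ f)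
    (e.injective.comp N.subtype_injective) (e.injective.comp hf)
  refine ⟨e.symm.toLinearMap ∘ₗ g ∘ₗ e.toLinearMap, fun n ↦ ?_⟩
  have h := hg n
  simp only [LinearMap.comp_apply, LinearEquiv.coe_coe, Submodule.subtype_apply] at h ⊢
  rw [h, e.symm_apply_apply]

/-- If `P × Q` is automorphism-invariant, then `Q` is injective relative to `P`. -/
theorem exists_extension_of_prod (h : IsAutomorphismInvariant A (P × Q)) (N : Submodule A P)
    (f : N →ₗ[A] Q) : ∃ g : P →ₗ[A] Q, ∀ n : N, g n = f n := by
  obtain ⟨g, hg⟩ := h.exists_extension (P := N × Q) (N.subtype.prodMap LinearMap.id)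
    ((N.subtype ∘ₗ LinearMap.fst A N Q).prod (f.coprod LinearMap.id))
    (by rintro ⟨x, y⟩ ⟨x', y'⟩; simp)
    (by
      rintro ⟨x, y⟩ ⟨x', y'⟩ hxy
      simp only [LinearMap.prod_apply, Function.prod_apply, LinearMap.comp_apply,
        LinearMap.fst_apply, Submodule.subtype_apply, LinearMap.coprod_apply, LinearMap.id_apply,
        Prod.mk.injEq, Subtype.coe_inj] at hxy ⊢
      obtain ⟨rfl, hxy⟩ := hxy
      simpa using hxy)
  refine ⟨LinearMap.snd A P Q ∘ₗ g ∘ₗ LinearMap.inl A P Q, fun n ↦ ?_⟩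
  have h := congrArg Prod.snd (hg (n, 0))
  simpa using h

end IsAutomorphismInvariant

section HereditarilyAutomorphismInvariant

variable {A M P Q : Type*} [Ring A] [AddCommGroup M] [Module A M] [AddCommGroup P] [Module A P]
  [AddCommGroup Q] [Module A Q]

theorem isAutomorphismInvariant_of_injective
    (hM : ∀ I : Submodule A M, IsAutomorphismInvariant A I)
    (j : P →ₗ[A] M) (hj : Function.Injective j) :
    IsAutomorphismInvariant A P :=
  (hM (LinearMap.range j)).of_linearEquiv_s5 (LinearEquiv.ofInjective j hj)

/-- A module whose square embeds in `M` is semisimple. -/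
theorem isSemisimpleModule_of_prod_injective
    (hM : ∀ I : Submodule A M, IsAutomorphismInvariant A I)
    (j : P × P →ₗ[A] M) (hj : Function.Injective j) :
    IsSemisimpleModule A P := by
  rw [isSemisimpleModule_iff]
  refine ⟨fun X ↦ ?_⟩
  have h : IsAutomorphismInvariant A (P × X) :=
    isAutomorphismInvariant_of_injective hM (j ∘ₗ LinearMap.id.prodMap X.subtype)
      (by
        refine hj.comp ?_
        rintro ⟨x, y⟩ ⟨x', y'⟩
        simp)
  obtain ⟨g, hg⟩ := h.exists_extension_of_prod X LinearMap.id
  exact ⟨LinearMap.ker g, LinearMap.isCompl_of_proj hg⟩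

/-- A submodule having an independent isomorphic copy is a direct summand. -/
theorem exists_isCompl_of_linearEquiv_of_disjoint
    (hM : ∀ I : Submodule A M, IsAutomorphismInvariant A I)
    {X Y : Submodule A M} (hXY : Disjoint X Y)
    (φ : X ≃ₗ[A] Y) : ∃ K, IsCompl X K := by
  have hT : IsAutomorphismInvariant A M :=
    isAutomorphismInvariant_of_injective hM LinearMap.id Function.injective_id
  obtain ⟨K, hYK, hK⟩ := zorn_le_nonempty₀ {K : Submodule A M | Disjoint X K}
    (fun c hc hc' y hy ↦ ⟨sSup c, by
      simpa [hc'.directedOn.disjoint_sSup_right] using fun a ha ↦ hc ha, fun z hz ↦ le_sSup hz⟩)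
    Y hXY
  have hXK : Disjoint X K := hK.prop
  have hmax : ∀ L, K ≤ L → Disjoint X L → L = K := fun L h h' ↦ (hK.eq_of_le h' h).symm
  have inj_of : ∀ (U V : Submodule A M), Disjoint U V →
      Function.Injective (U.subtype.coprod V.subtype) := by
    intro U V hUV
    rw [← LinearMap.ker_eq_bot, LinearMap.ker_coprod_of_disjoint_range] <;> simp [hUV]
  -- an endomorphism restricting to `φ` on `X` and vanishing on `K`
  obtain ⟨x, hxX, hxK⟩ : ∃ x : M →ₗ[A] M, (∀ a : X, x a = φ a) ∧ ∀ k ∈ K, x k = 0 := by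
    obtain ⟨c, hc⟩ := hT.exists_extension (P := X × K) (X.subtype.coprod K.subtype)
      ((X.subtype + Y.subtype ∘ₗ φ.toLinearMap).coprod K.subtype) (inj_of X K hXK) (by
        rw [injective_iff_map_eq_zero]
        rintro ⟨a, k⟩ h
        simp only [LinearMap.coprod_apply, LinearMap.add_apply, Submodule.subtype_apply,
          LinearMap.comp_apply, LinearEquiv.coe_coe] at h
        have ha : (a : M) = -((φ a : M) + k) := by
          rw [eq_neg_iff_add_eq_zero, ← h]; abel
        have ha0 : (a : M) = 0 := Submodule.disjoint_def.mp hXK _ a.2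
          (ha ▸ K.neg_mem (K.add_mem (hYK (φ a).2) k.2))
        have ha0' : a = 0 := Subtype.ext ha0
        subst ha0'
        simpa using h)
    refine ⟨c - LinearMap.id, fun a ↦ ?_, fun k hk ↦ ?_⟩
    · have h := hc (a, 0)
      simp at h
      simp [h]
    · have h := hc (0, ⟨k, hk⟩)
      simp at h
      simp [h]
  obtain ⟨y, hy⟩ := hT.exists_extension Y.subtype (X.subtype ∘ₗ φ.symm.toLinearMap)
    Y.subtype_injective (by simpa using X.subtype_injective.comp φ.symm.injective)
  obtain ⟨e, heX, heK⟩ : ∃ e : M →ₗ[A] M, (∀ a ∈ X, e a = a) ∧ ∀ k ∈ K, e k = 0 := by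
    refine ⟨y ∘ₗ x, fun a ha ↦ ?_, fun k hk ↦ by simp [hxK k hk]⟩
    have h := hy (φ ⟨a, ha⟩)
    have h' := hxX ⟨a, ha⟩
    simp at h h'
    simp [h', h]
  have hker : LinearMap.ker e = K := by
    refine hmax _ (fun k hk ↦ heK k hk) (Submodule.disjoint_def.mpr fun a ha h ↦ ?_)
    rw [← heX a ha]; exact h
  set U := LinearMap.range e with hU
  have hXU : X ≤ U := fun a ha ↦ ⟨a, heX a ha⟩
  -- `X` is essential in `U`
  have hess : ∀ N ≤ U, Disjoint X N → N = ⊥ := by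
    intro N hN hd
    have h1 : N.comap e = K := by
      refine hmax _ (fun k hk ↦ by simp [heK k hk]) (Submodule.disjoint_def.mpr fun a ha h ↦ ?_)
      exact Submodule.disjoint_def.mp hd a ha (by simpa [heX a ha] using h)
    rw [eq_bot_iff]
    intro n hn
    obtain ⟨m, rfl⟩ := hN hn
    have : m ∈ K := h1 ▸ hn
    simp [heK m this]
  have hinj : ∀ {Z : Type _} [AddCommGroup Z] [Module A Z] (h : U →ₗ[A] Z),
      (∀ a (ha : a ∈ X), h ⟨a, hXU ha⟩ = 0 → a = 0) → Function.Injective h := by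
    intro Z _ _ h hh
    rw [← LinearMap.ker_eq_bot]
    have := hess ((LinearMap.ker h).map U.subtype) (Submodule.map_subtype_le _ _)
      (Submodule.disjoint_def.mpr (by
        rintro a ha ⟨u, hu, rfl⟩
        exact hh _ ha hu))
    exact Submodule.map_injective_of_injective U.subtype_injective (by simpa using this)
  let eU : U →ₗ[A] U := (e.domRestrict U).codRestrict U fun u ↦ ⟨u, rfl⟩
  have heU : Function.Injective eU := hinj eU fun a ha h ↦ by
    exact (heX a ha).symm.trans (congrArg Subtype.val h)
  obtain ⟨g, hg⟩ := (hM U).exists_extension eU LinearMap.id heU Function.injective_id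
  have hginj : Function.Injective g := hinj g fun a ha h ↦ by
    have h1 := hg ⟨a, hXU ha⟩
    have h2 : eU ⟨a, hXU ha⟩ = ⟨a, hXU ha⟩ := Subtype.ext (heX a ha)
    rw [h2, h] at h1
    exact (congrArg Subtype.val h1).symm
  have hUK : IsCompl U K := by
    constructor
    · rw [Submodule.disjoint_def]
      intro u hu hk
      have : eU ⟨u, hu⟩ = 0 := Subtype.ext (heK u hk)
      exact congrArg Subtype.val ((map_eq_zero_iff eU heU).mp this)
    · rw [codisjoint_iff, eq_top_iff]
      intro m _
      let u := g ⟨e m, m, rfl⟩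
      have h1 : eU u = ⟨e m, m, rfl⟩ := hginj (hg u)
      have h2 : e u = e m := congrArg Subtype.val h1
      have h3 : m - u ∈ K := by
        rw [← hker, LinearMap.mem_ker, map_sub, h2, sub_self]
      rw [← add_sub_cancel (u : M) m]
      exact Submodule.add_mem_sup u.2 h3
  have hsub : U = X := by
    have hUKinv := isAutomorphismInvariant_of_injective hM _ (inj_of U K hUK.disjoint)
    obtain ⟨h, hh⟩ := hUKinv.exists_extension_of_prod (X.comap U.subtype)
      (Submodule.inclusion hYK ∘ₗ φ.toLinearMap ∘ₗ
        (U.subtype.submoduleComap X : X.comap U.subtype →ₗ[A] X))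
    have hhinj : Function.Injective h := hinj h fun a ha h0 ↦ by
      have h1 := hh ⟨⟨a, hXU ha⟩, ha⟩
      rw [h0] at h1
      have h2 := congrArg Subtype.val ((map_eq_zero_iff φ φ.injective).mp
        ((map_eq_zero_iff _ (Submodule.inclusion_injective hYK)).mp h1.symm))
      simpa using h2
    have hss : IsSemisimpleModule A U := isSemisimpleModule_of_prod_injective hM
      (U.subtype.coprod K.subtype ∘ₗ LinearMap.id.prodMap h) (
        (inj_of U K hUK.disjoint).comp (Function.injective_id.prodMap hhinj))
    obtain ⟨C, hC⟩ := exists_isCompl (X.comap U.subtype)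
    have hC0 : C.map U.subtype = ⊥ := by
      refine hess _ (Submodule.map_subtype_le _ _) (Submodule.disjoint_def.mpr ?_)
      rintro _ ha ⟨u, hu, rfl⟩
      exact congrArg Subtype.val (Submodule.disjoint_def.mp hC.disjoint u ha hu)
    have hC1 : C = ⊥ := 
      Submodule.map_injective_of_injective U.subtype_injective (by simpa using hC0)
    have hC2 := hC.sup_eq_top
    rw [hC1, sup_bot_eq, Submodule.comap_subtype_eq_top] at hC2
    exact le_antisymm hC2 hXU
  exact ⟨K, hsub ▸ hUK⟩

/-- In a finitely generated module, submodules whose square embeds are finitely generated. -/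
theorem finite_of_prod_injective [Module.Finite A M]
    (hM : ∀ I : Submodule A M, IsAutomorphismInvariant A I)
    (j : P × P →ₗ[A] M) (hj : Function.Injective j) : Module.Finite A P := by
  have hl : Function.Injective (j ∘ₗ LinearMap.inl A P P) := hj.comp LinearMap.inl_injective
  have hr : Function.Injective (j ∘ₗ LinearMap.inr A P P) := hj.comp LinearMap.inr_injective
  have hd : Disjoint (LinearMap.range (j ∘ₗ LinearMap.inl A P P))
      (LinearMap.range (j ∘ₗ LinearMap.inr A P P)) := by
    rw [Submodule.disjoint_def]
    rintro _ ⟨x, rfl⟩ ⟨y, hxy⟩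
    have h := congrArg Prod.snd (hj hxy)
    simp only [LinearMap.inr_apply, LinearMap.inl_apply] at h
    rw [← hxy, h, map_zero]
  obtain ⟨K, hK⟩ := exists_isCompl_of_linearEquiv_of_disjoint hM hd
    ((LinearEquiv.ofInjective _ hl).symm.trans (LinearEquiv.ofInjective _ hr))
  have := Module.Finite.equiv (Submodule.quotientEquivOfIsCompl K _ hK.symm)
  exact Module.Finite.equiv (LinearEquiv.ofInjective _ hl).symm

theorem finite_isotypicComponent [Module.Finite A M]
    (hM : ∀ I : Submodule A M, IsAutomorphismInvariant A I) (S : Submodule A M)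
    [IsSimpleModule A S] : Module.Finite A (isotypicComponent A M S) := by
  obtain ⟨ι, ⟨e⟩⟩ := (IsIsotypicOfType.isotypicComponent A M S).linearEquiv_finsupp
  obtain hι | hι := finite_or_infinite ι
  · exact Module.Finite.equiv e.symm
  · obtain ⟨σ⟩ : Nonempty (ι ≃ ι ⊕ ι) := Cardinal.eq.mp (by simp)
    let E := e.trans ((Finsupp.domLCongr σ).trans
      ((Finsupp.sumFinsuppLEquivProdFinsupp A).trans (e.symm.prodCongr e.symm)))
    exact finite_of_prod_injective hM ((isotypicComponent A M S).subtype ∘ₗ E.symm.toLinearMap)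
      ((isotypicComponent A M S).subtype_injective.comp E.symm.injective)

/-- Every isomorphic copy of a simple submodule having an independent copy is a direct summand. -/
theorem exists_isCompl_of_simple_of_disjoint
    (hM : ∀ I : Submodule A M, IsAutomorphismInvariant A I) {S S' T : Submodule A M}
    [IsSimpleModule A S] (hd : Disjoint S S') (φ : S ≃ₗ[A] S') (ψ : T ≃ₗ[A] S) :
    ∃ K, IsCompl T K := by
  have hT : IsAtom T := isSimpleModule_iff_isAtom.mp (IsSimpleModule.congr ψ)
  have hS : IsAtom S := isSimpleModule_iff_isAtom.mp inferInstance
  by_cases h : T = S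
  · subst h
    exact exists_isCompl_of_linearEquiv_of_disjoint hM hd φ
  · exact exists_isCompl_of_linearEquiv_of_disjoint hM (hT.disjoint_of_ne hS h) ψ

theorem exists_isCompl_of_le_isotypicComponent [Module.Finite A M]
    (hM : ∀ I : Submodule A M, IsAutomorphismInvariant A I) {S S' : Submodule A M}
    [IsSimpleModule A S] (hd : Disjoint S S') (φ : S ≃ₗ[A] S') {N : Submodule A M}
    (hN : N ≤ isotypicComponent A M S) : ∃ K, IsCompl N K := by
  have := finite_isotypicComponent hM S
  have hwf : IsNoetherian A N := isNoetherian_of_le hN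
  obtain ⟨X, ⟨hXN, K, hXK⟩, hX⟩ : ∃ X : Submodule A M, (X ≤ N ∧ ∃ K, IsCompl X K) ∧
      ∀ Y : Submodule A M, (Y ≤ N ∧ ∃ K, IsCompl Y K) → X ≤ Y → Y = X := by
    obtain ⟨X, hX, hmax⟩ := set_has_maximal_iff_noetherian.mpr hwf
      {X : Submodule A N | ∃ K, IsCompl (X.map N.subtype) K} ⟨⊥, ⊤, by simpa using isCompl_bot_top⟩
    refine ⟨X.map N.subtype, ⟨Submodule.map_subtype_le _ _, hX⟩, fun Y hY hle ↦ ?_⟩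
    have hYm : (Y.comap N.subtype).map N.subtype = Y := by
      rw [Submodule.map_comap_subtype, inf_eq_right.mpr hY.1]
    have h := hmax (Y.comap N.subtype) (by simpa only [Set.mem_ofPred_eq, hYm] using hY.2)
    have h' : X ≤ Y.comap N.subtype := Submodule.map_le_iff_le_comap.mp hle
    rw [← hYm, ← h'.eq_of_not_lt h]
  have hNK : N ⊓ K = ⊥ := by
    by_contra hne
    have hle : N ⊓ K ≤ isotypicComponent A M S := inf_le_left.trans hN
    have hss : IsSemisimpleModule A ↥(N ⊓ K) :=
      IsSemisimpleModule.of_injective _ (Submodule.inclusion_injective hle)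
    obtain ⟨T, hT, hTs⟩ := (IsSemisimpleModule.eq_bot_or_exists_simple_le (N ⊓ K)).resolve_left hne
    obtain ⟨ψ⟩ := isIsotypicOfType_submodule_iff.mp
      (IsIsotypicOfType.isotypicComponent A M S) T (hT.trans hle)
    obtain ⟨L, hL⟩ := exists_isCompl_of_simple_of_disjoint hM hd φ ψ
    have hTK : T ≤ K := hT.trans inf_le_right
    have hc : IsCompl (X ⊔ T) (L ⊓ K) := by
      constructor
      · have h1 : Disjoint T (L ⊓ K) := hL.disjoint.mono_right inf_le_left
        have h2 : Disjoint X (T ⊔ L ⊓ K) :=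
          hXK.disjoint.mono_right (sup_le hTK inf_le_right)
        exact h1.disjoint_sup_left_of_disjoint_sup_right h2
      · rw [codisjoint_iff, sup_assoc, ← sup_inf_assoc_of_le _ hTK, hL.sup_eq_top, top_inf_eq,
          hXK.sup_eq_top]
    have h := hX (X ⊔ T) ⟨sup_le hXN (hT.trans inf_le_left), _, hc⟩ le_sup_left
    have hTX : T ≤ X := h ▸ le_sup_right
    have hT0 : T = ⊥ := le_bot_iff.mp (hXK.disjoint hTX hTK)
    exact (isSimpleModule_iff_isAtom.mp hTs).1 hT0
  have hNX : N = X := by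
    refine le_antisymm ?_ hXN
    have h := sup_inf_assoc_of_le K hXN
    rw [hXK.sup_eq_top, top_inf_eq, inf_comm, hNK, sup_bot_eq] at h
    exact h.le
  exact ⟨K, hNX ▸ hXK⟩

/-- An independent pair of isomorphic nonzero submodules contains an independent pair of isomorphic
simple submodules. -/
theorem exists_simple_square (hM : ∀ I : Submodule A M, IsAutomorphismInvariant A I)
    {X Y : Submodule A M} (hX : X ≠ ⊥) (hd : Disjoint X Y) (φ : X ≃ₗ[A] Y) :
    ∃ S S' : Submodule A M, IsSimpleModule A S ∧ Disjoint S S' ∧ Nonempty (S ≃ₗ[A] S') := by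
  have hinj : Function.Injective (X.subtype.coprod Y.subtype) := by
    rw [← LinearMap.ker_eq_bot, LinearMap.ker_coprod_of_disjoint_range] <;> simp [hd]
  have hss : IsSemisimpleModule A X := isSemisimpleModule_of_prod_injective hM
    (X.subtype.coprod Y.subtype ∘ₗ LinearMap.id.prodMap φ.toLinearMap)
    (hinj.comp (Function.injective_id.prodMap φ.injective))
  obtain ⟨S, hS, hSs⟩ := (IsSemisimpleModule.eq_bot_or_exists_simple_le X).resolve_left hX
  let f : S →ₗ[A] M := Y.subtype ∘ₗ φ.toLinearMap ∘ₗ Submodule.inclusion hS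
  have hf : Function.Injective f :=
    Y.subtype_injective.comp (φ.injective.comp (Submodule.inclusion_injective hS))
  refine ⟨S, LinearMap.range f, hSs, hd.mono hS ?_, ⟨LinearEquiv.ofInjective f hf⟩⟩
  rintro _ ⟨s, rfl⟩
  exact (φ _).2

end HereditarilyAutomorphismInvariant

section RightModules

variable {R : Type*} [Ring R]

/-- Left multiplication as an endomorphism of the right regular module. -/
def leftMulRight (r : R) : R →ₗ[Rᵐᵒᵖ] R where
  toFun x := r * x
  map_add' := mul_add r
  map_smul' c x := by simp [MulOpposite.smul_eq_mul_unop, mul_assoc]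

/-- The right regular module is the regular module of the opposite ring. -/
def rightRegularEquiv : R ≃ₗ[Rᵐᵒᵖ] Rᵐᵒᵖ :=
  { MulOpposite.opAddEquiv with
    map_smul' := fun c x ↦ by simp [MulOpposite.smul_eq_mul_unop] }

theorem mul_mem_right_of_rightIdeal (I : Submodule Rᵐᵒᵖ R) {x : R} (hx : x ∈ I) (r : R) :
    x * r ∈ I := by
  simpa using I.smul_mem (MulOpposite.op r) hx

/-- A right ideal that is a direct summand contains an element acting on it as a left identity. -/
theorem exists_left_identity_of_isCompl {I K : Submodule Rᵐᵒᵖ R} (h : IsCompl I K) :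
    ∃ e ∈ I, ∀ x ∈ I, e * x = x := by
  obtain ⟨e, he, k, hk, hek⟩ := Submodule.mem_sup.mp
    (h.sup_eq_top ▸ Submodule.mem_top : (1 : R) ∈ I ⊔ K)
  refine ⟨e, he, fun x hx ↦ ?_⟩
  have hx' : x - e * x = k * x := by
    rw [sub_eq_iff_eq_add, ← add_mul, add_comm k, hek, one_mul]
  have h0 := Submodule.disjoint_def.mp h.disjoint (x - e * x)
    (I.sub_mem hx (mul_mem_right_of_rightIdeal I he x))
    (hx' ▸ mul_mem_right_of_rightIdeal K hk x)
  exact (sub_eq_zero.mp h0).symm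

theorem isSimpleRing_and_isArtinian_iff :
    (IsSimpleRing R ∧ IsArtinian Rᵐᵒᵖ R) ↔
      IsSemisimpleModule Rᵐᵒᵖ R ∧ IsIsotypic Rᵐᵒᵖ R ∧ Nontrivial R := by
  have h := isSimpleRing_isArtinianRing_iff (R := Rᵐᵒᵖ)
  have hs : IsSimpleRing Rᵐᵒᵖ ↔ IsSimpleRing R :=
    ⟨fun h ↦ ⟨TwoSidedIdeal.opOrderIso.isSimpleOrder⟩, fun h ↦ inferInstance⟩
  have ha : IsArtinianRing Rᵐᵒᵖ ↔ IsArtinian Rᵐᵒᵖ R :=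
    (rightRegularEquiv (R := R)).isArtinian_iff.symm
  have hss : IsSemisimpleRing Rᵐᵒᵖ ↔ IsSemisimpleModule Rᵐᵒᵖ R :=
    (rightRegularEquiv (R := R)).isSemisimpleModule_iff.symm
  have hi : IsIsotypic Rᵐᵒᵖ Rᵐᵒᵖ ↔ IsIsotypic Rᵐᵒᵖ R :=
    (rightRegularEquiv (R := R)).isIsotypic_iff.symm
  rwa [hs, ha, hss, hi, MulOpposite.opEquiv.symm.nontrivial_congr] at h

theorem IsSemisimpleModule.isAutomorphismInvariant {A M : Type*} [Ring A] [AddCommGroup M]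
    [Module A M] [IsSemisimpleModule A M] : IsAutomorphismInvariant A M := fun N f _ ↦ by
  obtain ⟨K, hK⟩ := exists_isCompl N
  exact ⟨f ∘ₗ N.projectionOnto K hK, fun n ↦ by simp⟩

/-- If every right ideal inside a fully invariant right ideal `H` is a direct summand, then `H` is
generated by a central idempotent. -/
theorem exists_central_idempotent_of_isCompl {H : Submodule Rᵐᵒᵖ R}
    (hl : ∀ r : R, ∀ x ∈ H, r * x ∈ H) (hc : ∀ N ≤ H, ∃ K, IsCompl N K) :
    ∃ e ∈ H, e ∈ Set.center R ∧ ∀ x ∈ H, e * x = x := by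
  obtain ⟨K, hK⟩ := hc H le_rfl
  obtain ⟨e, he, hid⟩ := exists_left_identity_of_isCompl hK
  refine ⟨e, he, Semigroup.mem_center_iff.mpr fun r ↦ ?_, hid⟩
  set x := e * r - r * e with hx
  have hxH : x ∈ H := H.sub_mem (mul_mem_right_of_rightIdeal H he r) (hl r e he)
  have hx0 : ∀ h ∈ H, x * h = 0 := fun h hh ↦ by
    rw [hx, sub_mul, mul_assoc, mul_assoc, hid h hh, hid _ (hl r h hh), sub_self]
  obtain ⟨L, hL⟩ := hc (rightIdealOf R x) (by
    rintro _ ⟨s, rfl⟩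
    exact mul_mem_right_of_rightIdeal H hxH s)
  obtain ⟨_, ⟨y, rfl⟩, hy⟩ := exists_left_identity_of_isCompl hL
  have h := hy x ⟨1, (mul_one x).symm⟩
  rw [mul_assoc, hx0 _ (hl y x hxH)] at h
  exact (sub_eq_zero.mp h.symm).symm

end RightModules

/-- an indecomposable ring containing a square is a right `a`-ring
iff it is simple artinian. -/
theorem indecomposable_with_square_rightARing_iff (R : Type*) [Ring R]
    (hind : ∀ e : R, IsIdempotentElem e → e ∈ Set.center R → e = 0 ∨ e = 1)
    (hsq : ∃ A B : Submodule Rᵐᵒᵖ R, A ≠ ⊥ ∧ B ≠ ⊥ ∧ A ⊓ B = ⊥ ∧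
      Nonempty ((A : Type _) ≃ₗ[Rᵐᵒᵖ] B)) :
    IsRightARing R ↔ (IsSimpleRing R ∧ IsArtinian Rᵐᵒᵖ R) := by
  constructor
  · intro hR
    obtain ⟨A, B, hA, -, hAB, ⟨φ⟩⟩ := hsq
    obtain ⟨S, S', hS, hd, ⟨ψ⟩⟩ := exists_simple_square hR hA (disjoint_iff.mpr hAB) φ
    have : Module.Finite Rᵐᵒᵖ R := Module.Finite.equiv rightRegularEquiv.symm
    have hc := fun N (hN : N ≤ isotypicComponent Rᵐᵒᵖ R S) ↦
      exists_isCompl_of_le_isotypicComponent hR hd ψ hN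
    have hpos := bot_lt_isotypicComponent S
    have hl : ∀ r : R, ∀ x ∈ isotypicComponent Rᵐᵒᵖ R S, r * x ∈ isotypicComponent Rᵐᵒᵖ R S :=
      fun r x hx ↦ LinearMap.le_comap_isotypicComponent S (leftMulRight r) hx
    obtain ⟨e, he, hcen, hid⟩ := exists_central_idempotent_of_isCompl hl hc
    have htop : isotypicComponent Rᵐᵒᵖ R S = ⊤ := by
      obtain rfl | rfl := hind e (hid e he) hcen
      · refine absurd (eq_bot_iff.mpr fun x hx ↦ ?_) hpos.ne'
        rw [← hid x hx, zero_mul]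
        exact Submodule.zero_mem _
      · exact eq_top_iff.mpr fun x _ ↦ by
          simpa using mul_mem_right_of_rightIdeal _ he x
    rw [isSimpleRing_and_isArtinian_iff]
    refine ⟨(isSemisimpleModule_iff _ _).mpr ⟨fun N ↦ hc N (htop ▸ le_top)⟩,
      (IsIsotypicOfType.of_isotypicComponent_eq_top htop).isIsotypic, ?_⟩
    obtain ⟨x, -, hx⟩ := Submodule.exists_mem_ne_zero_of_ne_bot hA
    exact ⟨x, 0, hx⟩
  · intro h I
    have := (isSimpleRing_and_isArtinian_iff.mp h).1
    exact IsSemisimpleModule.isAutomorphismInvariant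
end

section
/- For a ring R and an integer n > 1, the following conditions are equivalent: (1) the matrix ring M_n(R) is a right q-ring; (2) M_n(R) is a right a-ring; (3) R is a semisimple artinian ring. -/
theorem IsSemisimpleModule.isQuasiInjective {A M : Type*} [Ring A] [AddCommGroup M]
    [Module A M] [IsSemisimpleModule A M] : IsQuasiInjective A M := by
  intro N f
  obtain ⟨g, hg⟩ := IsSemisimpleModule.extension_property N.subtype N.injective_subtype f
  exact ⟨g, fun n ↦ LinearMap.congr_fun hg n⟩

theorem IsSemisimpleRing.isRightQRing (S : Type*) [Ring S] [IsSemisimpleRing S] :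
    IsRightQRing S :=
  fun _ ↦ IsSemisimpleModule.isQuasiInjective

theorem IsRightQRing.isRightARing {S : Type*} [Ring S] (h : IsRightQRing S) :
    IsRightARing S :=
  fun I N f _ ↦ h I N f

/-- The right ideal of matrices whose `i`-th row has entries in the right ideal `X i`
(a right ideal of `R` being a left ideal of `Rᵐᵒᵖ`). -/
def rowRightIdeal {R ι : Type*} [Ring R] [Fintype ι] [DecidableEq ι] (X : ι → Ideal Rᵐᵒᵖ) :
    Submodule (Matrix ι ι R)ᵐᵒᵖ (Matrix ι ι R) where
  carrier := {A | ∀ i j, MulOpposite.op (A i j) ∈ X i}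
  zero_mem' i j := by simp
  add_mem' ha hb i j := by simpa using (X i).add_mem (ha i j) (hb i j)
  smul_mem' c A hA i j := by
    rw [MulOpposite.smul_eq_mul_unop, Matrix.mul_apply, Finset.op_sum]
    exact (X i).sum_mem fun k _ ↦ by
      simpa using (X i).mul_mem_left (MulOpposite.op (c.unop k j)) (hA i k)

theorem mem_rowRightIdeal {R ι : Type*} [Ring R] [Fintype ι] [DecidableEq ι]
    {X : ι → Ideal Rᵐᵒᵖ} {A : Matrix ι ι R} :
    A ∈ rowRightIdeal X ↔ ∀ i j, MulOpposite.op (A i j) ∈ X i :=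
  Iff.rfl

/-- If matrices of size at least two form a right `a`-ring, then every right ideal of the
coefficient ring has a left identity. -/
theorem IsRightARing.exists_left_identity {R ι : Type*} [Ring R] [Fintype ι] [DecidableEq ι]
    (h : IsRightARing (Matrix ι ι R)) {a b : ι} (hab : a ≠ b) (X : Ideal Rᵐᵒᵖ) :
    ∃ e ∈ X, ∀ x ∈ X, x * e = x := by
  let I := rowRightIdeal (R := R) (Function.update (Function.update ⊥ b ⊤) a X)
  let J := rowRightIdeal (R := R) (Function.update ⊥ b X)
  have hJI : ∀ A ∈ J, A ∈ I := by
    intro A hA i j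
    have := hA i j
    by_cases hia : i = a
    · subst hia
      simp_all
    · by_cases hib : i = b <;> simp_all
  have hJ0 : ∀ A ∈ J, ∀ i ≠ b, ∀ j, A i j = 0 := by
    intro A hA i hi j
    simpa [hi] using hA i j
  have hJI' : ∀ A ∈ J, Matrix.single a b 1 * A ∈ I := by
    intro A hA i j
    by_cases hia : i = a
    · subst hia
      simpa using hA b j
    · simp [hia]
  let N : Submodule _ I := J.comap I.subtype
  let f : N →ₗ[(Matrix ι ι R)ᵐᵒᵖ] I :=
    { toFun := fun A ↦ ⟨Matrix.single a b 1 * A.1.1, hJI' _ A.2⟩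
      map_add' := fun A B ↦ Subtype.ext (mul_add _ _ _)
      map_smul' := fun c A ↦ Subtype.ext (by simp [MulOpposite.smul_eq_mul_unop, mul_assoc]) }
  have hf : Function.Injective f := by
    intro A B hAB
    ext i j
    by_cases hib : i = b
    · subst hib
      simpa [f] using congrFun₂ (congrArg Subtype.val hAB) a j
    · exact (hJ0 _ A.2 i hib j).trans (hJ0 _ B.2 i hib j).symm
  obtain ⟨g, hg⟩ := h I N f hf
  have hE : Matrix.single b b (1 : R) ∈ I := by
    intro i j
    by_cases hib : i = b
    · subst hib
      simp [hab.symm]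
    · simp [Matrix.single_apply_of_row_ne (Ne.symm hib)]
  refine ⟨.op ((g ⟨_, hE⟩).1 a b), by simpa using (g ⟨_, hE⟩).2 a b, fun x hx ↦ ?_⟩
  have hxJ : Matrix.single b b x.unop ∈ J := by
    intro i j
    by_cases hib : i = b
    · subst hib
      by_cases hj : i = j
      · subst hj; simpa using hx
      · simp [hj]
    · simp [Matrix.single_apply_of_row_ne (Ne.symm hib)]
  have hsm : (⟨_, hJI _ hxJ⟩ : I) =
      MulOpposite.op (Matrix.single b b x.unop) • (⟨_, hE⟩ : I) :=
    Subtype.ext (by simp [MulOpposite.smul_eq_mul_unop])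
  have key := (congrArg g hsm).symm.trans (hg ⟨⟨_, hJI _ hxJ⟩, hxJ⟩)
  rw [map_smul] at key
  have := congrFun₂ (congrArg Subtype.val key) a b
  apply MulOpposite.unop_injective
  simpa [f, MulOpposite.smul_eq_mul_unop] using this

theorem isSemisimpleRing_of_exists_right_identity {T : Type*} [Ring T]
    (h : ∀ X : Ideal T, ∃ e ∈ X, ∀ x ∈ X, x * e = x) : IsSemisimpleRing T := by
  refine (isSemisimpleModule_iff T T).mpr ⟨fun X ↦ ?_⟩
  obtain ⟨e, he, hX⟩ := h X
  exact ⟨_, LinearMap.isCompl_of_proj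
    (f := (LinearMap.toSpanSingleton T T e).codRestrict X fun t ↦ X.smul_mem t he)
    fun x ↦ Subtype.ext (hX x x.2)⟩

theorem IsRightARing.isSemisimpleRing {R ι : Type*} [Ring R] [Fintype ι] [DecidableEq ι]
    [Nontrivial ι] (h : IsRightARing (Matrix ι ι R)) : IsSemisimpleRing R := by
  obtain ⟨a, b, hab⟩ := exists_pair_ne ι
  exact isSemisimpleRing_mulOpposite_iff.mp
    (isSemisimpleRing_of_exists_right_identity (h.exists_left_identity hab))

/-- for `n > 1`, `Mₙ(R)` is a right `q`-ring iff it is a right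
`a`-ring iff `R` is semisimple artinian. -/
theorem matrixRing_rightARing_tfae (R : Type*) [Ring R] (n : ℕ) (hn : 1 < n) :
    List.TFAE
      [IsRightQRing (Matrix (Fin n) (Fin n) R),
       IsRightARing (Matrix (Fin n) (Fin n) R),
       IsSemisimpleRing R] := by
  have : Nontrivial (Fin n) := Fin.nontrivial_iff_two_le.mpr hn
  tfae_have 1 → 2 := IsRightQRing.isRightARing
  tfae_have 2 → 3 := IsRightARing.isSemisimpleRing
  tfae_have 3 → 1 := fun _ ↦ IsSemisimpleRing.isRightQRing _
  tfae_finish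
end
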